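/- arXiv:1505.05789 — 7 statements merged into one kernel-verified Lean document; each statement's English description precedes it below -/
import Mathlib

section
/- Let e, e_1, …, e_r be nonnegative integers with e > 0 and r ≥ 1, let B ≥ 1 be real, and let D ∈ (0,1] be real with D·B ≥ 1. Set ē := max{e_1, …, e_r}/e. Then the sum of ∏_{i=1}^r y_i^{e_i/e − 1} over all r-tuples (y_1, …, y_r) of positive integers satisfying max{y_1, …, y_r} ≤ B and ∏_{i=1}^r y_i^{e_i} ≤ D·B is at most max{1, ē·2^{ē}} · (D·B)^{1/e} · (1 + log B)^r. -/
open Finset Real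

/-- The harmonic sum up to `⌊B⌋₊` is at most `1 + log B`. -/
lemma sum_Icc_floor_inv_le_one_add_log {B : ℝ} (hB : 1 ≤ B) :
    ∑ k ∈ Finset.Icc 1 ⌊B⌋₊, (k : ℝ)⁻¹ ≤ 1 + Real.log B := by
  have h := harmonic_floor_le_one_add_log B hB
  simpa [harmonic_eq_sum_Icc] using h

/-- A product of powers `y i ^ (a i / e - 1)` is `(∏ y i ^ a i) ^ (1 / e)` divided by `∏ y i`. -/
lemma prod_rpow_div_sub_one {ι : Type*} (s : Finset ι) (y : ι → ℝ) (hy : ∀ i ∈ s, 0 < y i)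
    (a : ι → ℕ) (e : ℝ) :
    ∏ i ∈ s, y i ^ ((a i : ℝ) / e - 1) = (∏ i ∈ s, y i ^ a i) ^ (1 / e) * ∏ i ∈ s, (y i)⁻¹ := by
  rw [← Real.finsetProd_rpow s _ fun i hi => (pow_pos (hy i hi) _).le, ← Finset.prod_mul_distrib]
  refine Finset.prod_congr rfl fun i hi => ?_
  rw [Real.rpow_sub_one (hy i hi).ne', div_eq_mul_inv (_ ^ _), ← Real.rpow_natCast,
    ← Real.rpow_mul (hy i hi).le, mul_one_div]

open scoped Classical in
/-- Elementary counting inequality (Lemma: counting_lemma).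
The sum of `∏ i, y i ^ (e_i/e - 1)` over tuples of positive integers `y` with
`max y ≤ B` and `∏ i, y i ^ e_i ≤ D * B` is bounded by
`max 1 (ē 2^ē) * (D B)^(1/e) * (1 + log B)^r`, where `ē = max e_i / e`. -/
theorem counting_lemma (r : ℕ) (hr : 1 ≤ r) (e : ℕ) (he : 0 < e) (ev : Fin r → ℕ)
    (B D : ℝ) (hB : 1 ≤ B) (hD0 : 0 < D) (hD1 : D ≤ 1) (hDB : 1 ≤ D * B) :
    (∑ y ∈ Finset.filter
        (fun y : Fin r → ℕ => (∏ i, (y i : ℝ) ^ (ev i)) ≤ D * B)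
        (Fintype.piFinset fun _ : Fin r => Finset.Icc 1 ⌊B⌋₊),
      ∏ i, (y i : ℝ) ^ ((ev i : ℝ) / (e : ℝ) - 1))
    ≤ max 1 (((Finset.univ.sup ev : ℕ) : ℝ) / (e : ℝ)
          * (2 : ℝ) ^ (((Finset.univ.sup ev : ℕ) : ℝ) / (e : ℝ)))
        * (D * B) ^ ((1 : ℝ) / (e : ℝ)) * (1 + Real.log B) ^ r := by
  have hpos : ∀ y ∈ Fintype.piFinset fun _ : Fin r => Finset.Icc 1 ⌊B⌋₊,
      ∀ i, (0 : ℝ) < y i := fun y hy i =>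
    Nat.cast_pos.2 (Finset.mem_Icc.1 (Fintype.mem_piFinset.1 hy i)).1
  have hT : 0 ≤ (D * B) ^ ((1 : ℝ) / (e : ℝ)) := by positivity
  have hlog : 0 ≤ 1 + Real.log B := by linarith [Real.log_nonneg hB]
  calc
    _ ≤ ∑ y ∈ Finset.filter
          (fun y : Fin r → ℕ => (∏ i, (y i : ℝ) ^ (ev i)) ≤ D * B)
          (Fintype.piFinset fun _ : Fin r => Finset.Icc 1 ⌊B⌋₊),
        (D * B) ^ ((1 : ℝ) / (e : ℝ)) * ∏ i, (y i : ℝ)⁻¹ := by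
      refine Finset.sum_le_sum fun y hy => ?_
      obtain ⟨hy, hyT⟩ := Finset.mem_filter.1 hy
      rw [prod_rpow_div_sub_one _ _ fun i _ => hpos y hy i]
      gcongr
    _ ≤ ∑ y ∈ Fintype.piFinset fun _ : Fin r => Finset.Icc 1 ⌊B⌋₊,
        (D * B) ^ ((1 : ℝ) / (e : ℝ)) * ∏ i, (y i : ℝ)⁻¹ :=
      Finset.sum_le_sum_of_subset_of_nonneg (Finset.filter_subset _ _)
        fun y _ _ => by positivity
    _ = (D * B) ^ ((1 : ℝ) / (e : ℝ)) * (∑ k ∈ Finset.Icc 1 ⌊B⌋₊, (k : ℝ)⁻¹) ^ r := by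
      rw [← Finset.mul_sum, Finset.sum_prod_piFinset _ fun _ (k : ℕ) => (k : ℝ)⁻¹,
        Finset.prod_const, Finset.card_univ, Fintype.card_fin]
    _ ≤ (D * B) ^ ((1 : ℝ) / (e : ℝ)) * (1 + Real.log B) ^ r := by
      gcongr
      exact sum_Icc_floor_inv_le_one_add_log hB
    _ ≤ _ := by
      gcongr
      exact le_mul_of_one_le_left hT (le_max_left _ _)
end

section
/- For every real s > 1/f the following hold: (a) Σ_{d ∈ I^R} |μ(d)|/N(d)^s < ∞; (b) for every maximal ideal p of 𝓞 the sum s_p(s) := Σ μ(d)/N(d)^s, taken over those d ∈ I^R all of whose components are (possibly zeroth) powers of p, has only finitely many nonzero terms; (c) the infinite product ∏_p s_p(s) over all maximal ideals p of 𝓞 converges absolutely and equals Σ_{d ∈ I^R} μ(d)/N(d)^s. -/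
open NumberField

theorem exists_sum_Iic_eq {α M : Type*} [PartialOrder α] [LocallyFiniteOrderBot α]
    [WellFoundedLT α] [AddCommGroup M] (c : α → M) :
    ∃ h : α → M, ∀ x, ∑ y ∈ Finset.Iic x, h y = c x := by
  classical
  let h : α → M := wellFounded_lt.fix fun x ih =>
    c x - ∑ y ∈ (Finset.Iio x).attach, ih y (Finset.mem_Iio.1 y.2)
  have h_eq x : h x = c x - ∑ y ∈ Finset.Iio x, h y := by
    rw [← Finset.sum_attach]
    exact wellFounded_lt.fix_eq _ x
  refine ⟨h, fun x => ?_⟩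
  rw [← Finset.Iio_insert, Finset.sum_insert (by simp), h_eq x]
  abel

theorem Finset.sum_finsupp {ι α M : Type*} [Zero α] [CommSemiring M] (s : Finset ι)
    (t : ι → Finset α) (a : ι → α → M) :
    ∑ F ∈ s.finsupp t, ∏ i ∈ s, a i (F i) = ∏ i ∈ s, ∑ x ∈ t i, a i x := by
  classical
  rw [Finset.prod_sum, Finset.finsupp, Finset.sum_map]
  refine Finset.sum_congr rfl fun F _ => ?_
  rw [← Finset.prod_attach]
  refine Finset.prod_congr rfl fun i _ => ?_
  simp

theorem sum_finsupp_prod_eq_prod_sum {ι α M : Type*} [Zero α] [CommSemiring M] (s : Finset ι)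
    (t : ι → Finset α) (a : ι → α → M) (ha : ∀ i, a i 0 = 1) :
    ∑ F ∈ s.finsupp t, F.prod a = ∏ i ∈ s, ∑ x ∈ t i, a i x := by
  rw [← Finset.sum_finsupp]
  refine Finset.sum_congr rfl fun F hF => ?_
  exact Finsupp.prod_of_support_subset _ (Finset.mem_finsupp_iff.1 hF).1 _ fun i _ => ha i

section EulerProduct

variable {ι α : Type*} [Zero α] [DecidableEq α] {E : Finset α} {a : ι → α → ℝ}

theorem summable_abs_finsupp_prod (ha : ∀ i, a i 0 = 1) (haE : ∀ i, ∀ x ∉ E, a i x = 0)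
    (hsum : Summable fun i => ∑ x ∈ E.erase 0, |a i x|) :
    Summable fun F : ι →₀ α => |F.prod a| := by
  have hnn i : 0 ≤ ∑ x ∈ E.erase 0, |a i x| := Finset.sum_nonneg fun _ _ => abs_nonneg _
  have h_abs (F : ι →₀ α) : |F.prod a| = F.prod fun i x => |a i x| := Finset.abs_prod _ _
  simp_rw [h_abs]
  have h_nn (F : ι →₀ α) : 0 ≤ F.prod fun i x => |a i x| :=
    Finset.prod_nonneg fun _ _ => abs_nonneg _
  refine summable_of_sum_le (c := Real.exp (∑' i, ∑ x ∈ E.erase 0, |a i x|)) h_nn fun u => ?_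
  classical
  let U : Finset ι := u.biUnion Finsupp.support
  calc ∑ F ∈ u, (F.prod fun i x => |a i x|)
      ≤ ∑ F ∈ U.finsupp fun _ => insert 0 (E.erase 0), F.prod fun i x => |a i x| := by
        rw [← Finset.sum_filter_ne_zero u]
        refine Finset.sum_le_sum_of_subset_of_nonneg (fun F hF => ?_) fun F _ _ => h_nn F
        obtain ⟨hF, hne⟩ := Finset.mem_filter.1 hF
        refine Finset.mem_finsupp_iff.2 ⟨Finset.subset_biUnion_of_mem _ hF, fun i _ => ?_⟩
        by_contra hi
        simp only [Finset.mem_insert, Finset.mem_erase, not_or, not_and] at hi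
        refine hne (Finset.prod_eq_zero (Finsupp.mem_support_iff.2 hi.1) ?_)
        simp [haE i _ (hi.2 hi.1)]
    _ = ∏ i ∈ U, ∑ x ∈ insert 0 (E.erase 0), |a i x| :=
        sum_finsupp_prod_eq_prod_sum _ _ _ (by simp [ha])
    _ = ∏ i ∈ U, (1 + ∑ x ∈ E.erase 0, |a i x|) :=
        Finset.prod_congr rfl fun i _ => by rw [Finset.sum_insert (by simp), ha, abs_one]
    _ ≤ Real.exp (∑ i ∈ U, ∑ x ∈ E.erase 0, |a i x|) := Real.prod_one_add_le_exp_sum _ hnn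
    _ ≤ _ := Real.exp_le_exp.2 (hsum.sum_le_tsum _ fun i _ => hnn i)

theorem hasSum_finsupp_prod_support_eq (haE : ∀ i, ∀ x ∉ E, a i x = 0) (T : Finset ι)
    (ha : ∀ i, a i 0 = 1) :
    HasSum (fun F : (Finsupp.support ⁻¹' {T} : Set (ι →₀ α)) => (F : ι →₀ α).prod a)
      (∏ i ∈ T, ∑ x ∈ E.erase 0, a i x) := by
  rw [← sum_finsupp_prod_eq_prod_sum _ _ _ ha]
  refine (hasSum_subtype_iff_indicator (f := fun F : ι →₀ α => F.prod a)).2 ?_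
  have hmem : ∀ F ∈ T.finsupp fun _ => E.erase 0, F.support = T := fun F hF => by
    rw [Finset.mem_finsupp_iff] at hF
    exact hF.1.antisymm fun i hi => Finsupp.mem_support_iff.2 (Finset.ne_of_mem_erase (hF.2 i hi))
  rw [← Finset.sum_congr rfl fun F hF => Set.indicator_of_mem
    (s := Finsupp.support ⁻¹' {T}) (hmem F hF) (fun F : ι →₀ α => F.prod a)]
  refine hasSum_sum_of_ne_finset_zero fun F hF => ?_
  by_cases hFT : F.support = T
  · rw [Set.indicator_of_mem (by exact hFT)]
    by_contra hne
    refine hF (Finset.mem_finsupp_iff.2 ⟨hFT.le, fun i hi => ?_⟩)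
    rw [← hFT] at hi
    refine Finset.mem_erase.2 ⟨Finsupp.mem_support_iff.1 hi, ?_⟩
    by_contra hiE
    exact hne (Finset.prod_eq_zero hi (haE i _ hiE))
  · exact Set.indicator_of_notMem (s := Finsupp.support ⁻¹' {T}) hFT _

theorem hasProd_sum_of_summable (ha : ∀ i, a i 0 = 1) (h0 : 0 ∈ E)
    (haE : ∀ i, ∀ x ∉ E, a i x = 0)
    (hsum : Summable fun i => ∑ x ∈ E.erase 0, |a i x|) :
    HasProd (fun i => ∑ x ∈ E, a i x) (∑' F : ι →₀ α, F.prod a) := by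
  have key := (summable_abs_finsupp_prod ha haE hsum).of_abs.hasSum.tsum_fiberwise Finsupp.support
  simp_rw [(hasSum_finsupp_prod_support_eq haE _ ha).tsum_eq] at key
  have hE i : ∑ x ∈ E, a i x = 1 + ∑ x ∈ E.erase 0, a i x := by
    rw [← ha i, Finset.add_sum_erase _ _ h0]
  simp_rw [hE]
  exact hasProd_one_add_of_hasSum_prod key

end EulerProduct

theorem isBigO_sum_card_absNorm_eq (K : Type*) [Field K] [NumberField K] :
    (fun n : ℕ => ∑ k ∈ Finset.Icc 1 n,
      (Nat.card {I : Ideal (𝓞 K) // Ideal.absNorm I = k} : ℝ)) =O[Filter.atTop]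
      fun n : ℕ => (n : ℝ) ^ (1 : ℝ) := by
  have h1 := ((NumberField.Ideal.tendsto_norm_le_div_atTop₀ K).comp
    tendsto_natCast_atTop_atTop).isBigO_one ℝ
  have h2 := h1.mul (Asymptotics.isBigO_refl (fun n : ℕ => (n : ℝ)) Filter.atTop)
  refine h2.congr' ?_ (by simp)
  filter_upwards [Filter.eventually_gt_atTop 0] with n hn
  simp only [Function.comp_apply, Nat.cast_le, ← Nat.cast_sum]
  rw [div_mul_cancel₀ _ (by positivity)]
  congr 1
  rw [← add_left_inj 1, ← Ideal.card_norm_le_eq_card_norm_le_add_one,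
    show Finset.Icc 1 n = Finset.Ioc 0 n from Finset.Icc_succ_left_eq_Ioc _ _,
    show 1 = Nat.card {I : Ideal (𝓞 K) // Ideal.absNorm I = 0} by
      simp [Ideal.absNorm_eq_zero_iff],
    Finset.sum_Ioc_add_eq_sum_Icc (n.zero_le),
    ← Finset.card_preimage_eq_sum_card_image_eq
      (fun k _ ↦ Ideal.finite_setOfPred_absNorm_eq k)]
  simp [Set.coe_eq_subtype]

theorem summable_card_absNorm_eq (K : Type*) [Field K] [NumberField K] {t : ℝ} (ht : 1 < t) :
    Summable fun n : ℕ =>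
      (Nat.card {I : Ideal (𝓞 K) // Ideal.absNorm I = n} : ℝ) * (n : ℝ) ^ (-t) := by
  have hL := LSeriesSummable_of_sum_norm_bigO_and_nonneg (s := (t : ℂ))
    (isBigO_sum_card_absNorm_eq K) (fun n => Nat.cast_nonneg _) zero_le_one (by simpa using ht)
  refine hL.norm.congr_cofinite ?_
  filter_upwards [(Set.finite_singleton 0).compl_mem_cofinite] with n hn
  have hn : n ≠ 0 := hn
  rw [LSeries.term_of_ne_zero hn, norm_div, Complex.norm_natCast_cpow_of_pos (by positivity),
    Real.rpow_neg (by positivity)]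
  simp [div_eq_mul_inv]

theorem summable_absNorm_rpow (K : Type*) [Field K] [NumberField K] {t : ℝ} (ht : 1 < t) :
    Summable fun I : Ideal (𝓞 K) => (Ideal.absNorm I : ℝ) ^ (-t) := by
  classical
  have hc := summable_card_absNorm_eq K ht
  refine summable_of_sum_le (fun _ => by positivity) (c := ∑' n : ℕ,
    (Nat.card {I : Ideal (𝓞 K) // Ideal.absNorm I = n} : ℝ) * (n : ℝ) ^ (-t)) fun u => ?_
  rw [← Finset.sum_fiberwise_of_maps_to (t := u.image fun I => Ideal.absNorm I)
    (g := fun I => Ideal.absNorm I) (fun I hI => Finset.mem_image_of_mem _ hI)]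
  refine le_trans (Finset.sum_le_sum fun n _ => ?_)
    (hc.sum_le_tsum _ fun n _ => mul_nonneg (Nat.cast_nonneg _) (by positivity))
  rw [Finset.sum_congr rfl fun I hI => by rw [(Finset.mem_filter.1 hI).2], Finset.sum_const,
    nsmul_eq_mul]
  refine mul_le_mul_of_nonneg_right (Nat.cast_le.2 ?_) (by positivity)
  have hfin := Ideal.finite_setOfPred_absNorm_eq (S := 𝓞 K) n
  refine (Finset.card_le_card (t := hfin.toFinset) fun I hI => ?_).trans_eq
    (Nat.card_eq_card_finite_toFinset hfin).symm
  simpa using (Finset.mem_filter.1 hI).2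

theorem eq_of_sum_le_eq {β M : Type*} [PartialOrder β] [WellFoundedLT β] [AddCommGroup M]
    (D : β → Finset β) (hD : ∀ x y, y ∈ D x ↔ y ≤ x) {u v : β → M}
    (h : ∀ x, ∑ y ∈ D x, u y = ∑ y ∈ D x, v y) : u = v := by
  classical
  funext x
  induction x using WellFoundedLT.induction with
  | _ x ih =>
    have hx := h x
    rw [← Finset.add_sum_erase _ _ ((hD x x).2 le_rfl),
      ← Finset.add_sum_erase _ _ ((hD x x).2 le_rfl),
      Finset.sum_congr rfl fun y hy => ih y ?_] at hx
    · exact add_right_cancel hx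
    · exact ((hD x y).1 (Finset.mem_of_mem_erase hy)).lt_of_ne (Finset.ne_of_mem_erase hy)

section LocalFactor

variable {R : Type*} {𝒞 : Finset (Finset R)}

/-- The exponent vectors whose support is contained in a member of `𝒞`. -/
def IsAdmissible (𝒞 : Finset (Finset R)) (m : R → ℕ) : Prop := ∃ σ ∈ 𝒞, ∀ ρ ∉ σ, m ρ = 0

theorem IsAdmissible.mono {m n : R → ℕ} (hn : IsAdmissible 𝒞 n)
    (hmn : ∀ ρ, n ρ = 0 → m ρ = 0) : IsAdmissible 𝒞 m :=
  let ⟨σ, hσ, h⟩ := hn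
  ⟨σ, hσ, fun ρ hρ => hmn ρ (h ρ hρ)⟩

theorem isAdmissible_zero (h𝒞 : 𝒞.Nonempty) : IsAdmissible 𝒞 0 :=
  let ⟨σ, hσ⟩ := h𝒞
  ⟨σ, hσ, fun _ _ => rfl⟩

variable [Fintype R] [DecidableEq R]

open scoped Classical in
/-- The local Möbius function attached to `𝒞`. -/
noncomputable def localMoebius (𝒞 : Finset (Finset R)) : (R → ℕ) → ℤ :=
  (exists_sum_Iic_eq fun m => if IsAdmissible 𝒞 m then (1 : ℤ) else 0).choose

open scoped Classical in
theorem sum_localMoebius (m : R → ℕ) :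
    ∑ e ∈ Finset.Iic m, localMoebius 𝒞 e = if IsAdmissible 𝒞 m then 1 else 0 :=
  (exists_sum_Iic_eq fun m => if IsAdmissible 𝒞 m then (1 : ℤ) else 0).choose_spec m

theorem localMoebius_zero (h𝒞 : 𝒞.Nonempty) : localMoebius 𝒞 0 = 1 := by
  have h := sum_localMoebius (𝒞 := 𝒞) 0
  rw [if_pos (isAdmissible_zero h𝒞), show Finset.Iic (0 : R → ℕ) = {0} by ext; simp] at h
  simpa using h

theorem localMoebius_eq_zero_of_not_le_one {m : R → ℕ} (hm : ¬ m ≤ 1) :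
    localMoebius 𝒞 m = 0 := by
  induction m using WellFoundedLT.induction with
  | _ m ih =>
    have hiff : IsAdmissible 𝒞 (m ⊓ 1) ↔ IsAdmissible 𝒞 m :=
      ⟨fun h => h.mono fun ρ => by simp, fun h => h.mono fun ρ => by simp +contextual⟩
    have h1 : ∑ e ∈ Finset.Iic m, localMoebius 𝒞 e =
        ∑ e ∈ Finset.Iic (m ⊓ 1), localMoebius 𝒞 e := by
      classical
      rw [sum_localMoebius, sum_localMoebius]
      exact if_congr hiff.symm rfl rfl
    have hsub : insert m (Finset.Iic (m ⊓ 1)) ⊆ Finset.Iic m := by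
      refine Finset.insert_subset (by simp) (Finset.Iic_subset_Iic.2 inf_le_left)
    rw [← Finset.sum_subset hsub, Finset.sum_insert] at h1
    · simpa using h1
    · simpa using hm
    · intro e he hne
      simp only [Finset.mem_insert, Finset.mem_Iic, le_inf_iff, not_or, not_and] at he hne
      exact ih e (he.lt_of_ne hne.1) (hne.2 he)

theorem localMoebius_eq_zero_of_isAdmissible (h𝒞 : 𝒞.Nonempty) {m : R → ℕ} (hm0 : m ≠ 0)
    (hm : IsAdmissible 𝒞 m) : localMoebius 𝒞 m = 0 := by
  induction m using WellFoundedLT.induction with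
  | _ m ih =>
    have h1 := sum_localMoebius (𝒞 := 𝒞) m
    have hsub : {m, 0} ⊆ Finset.Iic m := by
      simp [Finset.insert_subset_iff]
    rw [← Finset.sum_subset hsub, Finset.sum_pair hm0, localMoebius_zero h𝒞, if_pos hm] at h1
    · simpa using h1
    · intro e he hne
      simp only [Finset.mem_insert, Finset.mem_Iic, Finset.mem_singleton, not_or] at he hne
      refine ih e (he.lt_of_ne hne.1) hne.2 (hm.mono fun ρ hρ => ?_)
      have := he ρ
      lia

theorem le_sum_of_localMoebius_ne_zero (h𝒞 : 𝒞.Nonempty) {f : ℕ}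
    (hf : IsLeast {k : ℕ | ∃ S : Finset R, S.card = k ∧ ∀ σ ∈ 𝒞, ¬ S ⊆ σ} f)
    {m : R → ℕ} (hm0 : m ≠ 0) (hm : localMoebius 𝒞 m ≠ 0) : f ≤ ∑ ρ, m ρ := by
  have hS : ∀ σ ∈ 𝒞, ¬ (Finset.univ.filter fun ρ => m ρ ≠ 0) ⊆ σ := fun σ hσ hsub =>
    hm (localMoebius_eq_zero_of_isAdmissible h𝒞 hm0 ⟨σ, hσ, fun ρ hρ => by
      by_contra h
      exact hρ (hsub (by simpa using h))⟩)
  calc f ≤ (Finset.univ.filter fun ρ => m ρ ≠ 0).card := hf.2 ⟨_, rfl, hS⟩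
    _ = ∑ ρ ∈ Finset.univ.filter fun ρ => m ρ ≠ 0, 1 := by simp
    _ ≤ ∑ ρ ∈ Finset.univ.filter fun ρ => m ρ ≠ 0, m ρ := Finset.sum_le_sum fun ρ hρ =>
        Nat.one_le_iff_ne_zero.2 (Finset.mem_filter.1 hρ).2
    _ ≤ ∑ ρ, m ρ := Finset.sum_le_sum_of_subset (Finset.filter_subset _ _)

end LocalFactor

section Exponents

variable {A : Type*} [CommRing A]

/-- The nonzero ideal with prescribed exponents at the maximal ideals. -/
noncomputable def idealOfExponents (x : {p : Ideal A // p.IsMaximal} →₀ ℕ) : Ideal A :=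
  x.prod fun p n => p.1 ^ n

variable {R : Type*}

/-- The tuple of nonzero ideals with prescribed exponent vectors at the maximal ideals. -/
noncomputable def tupleOfExponents (F : {p : Ideal A // p.IsMaximal} →₀ (R → ℕ)) (ρ : R) :
    Ideal A :=
  idealOfExponents (F.mapRange (fun e => e ρ) rfl)

theorem tupleOfExponents_apply (F : {p : Ideal A // p.IsMaximal} →₀ (R → ℕ)) (ρ : R) :
    tupleOfExponents F ρ = F.prod fun p e => p.1 ^ e ρ :=
  Finsupp.prod_mapRange_index fun _ => pow_zero _

theorem tupleOfExponents_single (p : {p : Ideal A // p.IsMaximal}) (e : R → ℕ) :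
    tupleOfExponents (Finsupp.single p e) = fun ρ => p.1 ^ e ρ := by
  funext ρ
  rw [tupleOfExponents_apply, Finsupp.prod_single_index (by simp)]

variable [IsDedekindDomain A]

theorem prime_of_isMaximal (hA : ¬ IsField A) (p : {p : Ideal A // p.IsMaximal}) : Prime p.1 :=
  have := p.2
  Ideal.prime_of_isPrime (Ring.ne_bot_of_isMaximal_of_not_isField p.2 hA) inferInstance

theorem idealOfExponents_ne_bot (hA : ¬ IsField A) (x : {p : Ideal A // p.IsMaximal} →₀ ℕ) :
    idealOfExponents x ≠ ⊥ :=
  Finset.prod_ne_zero_iff.2 fun p _ => pow_ne_zero _ (prime_of_isMaximal hA p).ne_zero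

theorem idealOfExponents_le_iff (hA : ¬ IsField A) (x y : {p : Ideal A // p.IsMaximal} →₀ ℕ) :
    idealOfExponents y ≤ idealOfExponents x ↔ x ≤ y := by
  classical
  rw [← Ideal.dvd_iff_le]
  refine ⟨fun h p => ?_, fun h => ?_⟩
  · have hx : p.1 ^ x p ∣ idealOfExponents x := by
      by_cases hp : p ∈ x.support
      · exact Finset.dvd_prod_of_mem _ hp
      · simp [Finsupp.notMem_support_iff.1 hp]
    have hy : idealOfExponents y = p.1 ^ y p * ∏ q ∈ y.support.erase p, q.1 ^ y q := by
      rw [idealOfExponents, ← Finsupp.mul_prod_erase' y p _ fun _ => pow_zero _]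
      congr 1
      rw [Finsupp.prod, Finsupp.support_erase]
      refine Finset.prod_congr rfl fun q hq => ?_
      rw [Finsupp.erase_ne (Finset.ne_of_mem_erase hq)]
    have hp := prime_of_isMaximal hA p
    have hnd : ¬ p.1 ∣ ∏ q ∈ y.support.erase p, q.1 ^ y q := fun hd => by
      obtain ⟨q, hq, hpq⟩ := (hp.dvd_finsetProd_iff _).1 hd
      have hpq := Ideal.le_of_dvd (hp.dvd_of_dvd_pow hpq)
      exact Finset.ne_of_mem_erase hq (Subtype.ext (q.2.eq_of_le p.2.ne_top hpq))
    have := hp.pow_dvd_of_dvd_mul_right _ hnd (hy ▸ hx.trans h)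
    exact (pow_dvd_pow_iff hp.ne_zero hp.not_isUnit).1 this
  · rw [idealOfExponents, Finsupp.prod_of_support_subset x (Finsupp.support_mono h) _
      fun _ _ => pow_zero _]
    exact Finset.prod_dvd_prod_of_dvd _ _ fun p _ => pow_dvd_pow _ (h p)

theorem exists_idealOfExponents_eq {I : Ideal A} (hI : I ≠ ⊥) :
    ∃ x : {p : Ideal A // p.IsMaximal} →₀ ℕ, idealOfExponents x = I := by
  classical
  induction I using UniqueFactorizationMonoid.induction_on_prime with
  | h₁ => exact absurd rfl hI
  | h₂ I hu => exact ⟨0, by simp [idealOfExponents, Ideal.isUnit_iff.1 hu, Ideal.one_eq_top]⟩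
  | h₃ I p hI0 hp ih =>
    obtain ⟨x, rfl⟩ := ih hI0
    have hpm : p.IsMaximal := (Ideal.isPrime_of_prime hp).isMaximal hp.ne_zero
    refine ⟨Finsupp.single ⟨p, hpm⟩ 1 + x, ?_⟩
    rw [idealOfExponents, Finsupp.prod_add_index' (fun _ => pow_zero _) fun _ _ _ => pow_add _ _ _,
      Finsupp.prod_single_index (by simp), pow_one, idealOfExponents]

theorem tupleOfExponents_ne_bot (hA : ¬ IsField A) (F : {p : Ideal A // p.IsMaximal} →₀ (R → ℕ))
    (ρ : R) : tupleOfExponents F ρ ≠ ⊥ :=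
  idealOfExponents_ne_bot hA _

theorem tupleOfExponents_le_iff (hA : ¬ IsField A)
    (F G : {p : Ideal A // p.IsMaximal} →₀ (R → ℕ)) :
    (∀ ρ, tupleOfExponents F ρ ≤ tupleOfExponents G ρ) ↔ G ≤ F := by
  simp_rw [tupleOfExponents, idealOfExponents_le_iff hA, Finsupp.le_def, Pi.le_def,
    Finsupp.mapRange_apply]
  exact forall_comm

theorem tupleOfExponents_injective (hA : ¬ IsField A) :
    Function.Injective (tupleOfExponents (A := A) (R := R)) := fun F G h =>
  le_antisymm ((tupleOfExponents_le_iff hA G F).1 fun ρ => by rw [h])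
    ((tupleOfExponents_le_iff hA F G).1 fun ρ => by rw [h])

theorem exists_tupleOfExponents_eq [Finite R] {d : R → Ideal A} (hd : ∀ ρ, d ρ ≠ ⊥) :
    ∃ F : {p : Ideal A // p.IsMaximal} →₀ (R → ℕ), tupleOfExponents F = d := by
  classical
  have := Fintype.ofFinite R
  choose x hx using fun ρ => exists_idealOfExponents_eq (hd ρ)
  refine ⟨Finsupp.onFinset (Finset.univ.biUnion fun ρ => (x ρ).support) (fun p ρ => x ρ p)
    fun p hp => ?_, funext fun ρ => ?_⟩
  · obtain ⟨ρ, hρ⟩ := Function.ne_iff.1 hp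
    exact Finset.mem_biUnion.2 ⟨ρ, Finset.mem_univ _, Finsupp.mem_support_iff.2 hρ⟩
  · rw [tupleOfExponents, ← hx ρ]
    congr 1
    ext p
    simp

theorem idealOfExponents_le_maximal_iff (hA : ¬ IsField A)
    (x : {p : Ideal A // p.IsMaximal} →₀ ℕ) (p : {p : Ideal A // p.IsMaximal}) :
    idealOfExponents x ≤ p.1 ↔ x p ≠ 0 := by
  have hp : p.1 = idealOfExponents (Finsupp.single p 1) := by
    rw [idealOfExponents, Finsupp.prod_single_index (by simp), pow_one]
  rw [hp, idealOfExponents_le_iff hA, Finsupp.single_le_iff, Nat.one_le_iff_ne_zero]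

theorem sum_prod_tupleOfExponents_eq_top_iff [Fintype R] [DecidableEq R] (hA : ¬ IsField A)
    (𝒞 : Finset (Finset R)) (F : {p : Ideal A // p.IsMaximal} →₀ (R → ℕ)) :
    (∑ σ ∈ 𝒞, ∏ ρ ∈ σᶜ, tupleOfExponents F ρ) = ⊤ ↔ ∀ p, IsAdmissible 𝒞 (F p) := by
  have key (p : {p : Ideal A // p.IsMaximal}) :
      (∑ σ ∈ 𝒞, ∏ ρ ∈ σᶜ, tupleOfExponents F ρ) ≤ p.1 ↔ ¬ IsAdmissible 𝒞 (F p) := by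
    have := p.2
    simp_rw [Ideal.sum_eq_sup, Finset.sup_le_iff, Ideal.IsPrime.prod_le p.2.isPrime,
      tupleOfExponents, idealOfExponents_le_maximal_iff hA, IsAdmissible]
    simp
  refine ⟨fun h p => ?_, fun h => ?_⟩
  · by_contra hp
    exact p.2.ne_top (top_le_iff.1 (h ▸ (key p).2 hp))
  · by_contra hne
    obtain ⟨p, hp, hle⟩ := Ideal.exists_le_maximal _ hne
    exact (key ⟨p, hp⟩).1 hle (h _)

end Exponents

section NumberField

variable {K : Type*} [Field K] [NumberField K] {R : Type*} [Fintype R] [DecidableEq R]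
  {𝒞 : Finset (Finset R)} {μ : (R → Ideal (𝓞 K)) → ℤ}

open scoped Classical in
theorem moebius_tupleOfExponents (h𝒞 : 𝒞.Nonempty)
    (hμ : ∀ b : R → Ideal (𝓞 K), (∀ ρ, b ρ ≠ ⊥) →
      (if (∑ σ ∈ 𝒞, ∏ ρ ∈ σᶜ, b ρ) = ⊤ then (1 : ℤ) else 0) =
        ∑ᶠ d ∈ {d : R → Ideal (𝓞 K) | (∀ ρ, d ρ ≠ ⊥) ∧ ∀ ρ, b ρ ≤ d ρ}, μ d)
    (F : {p : Ideal (𝓞 K) // p.IsMaximal} →₀ (R → ℕ)) :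
    μ (tupleOfExponents F) = F.prod fun _ e => localMoebius 𝒞 e := by
  have hA := RingOfIntegers.not_isField K
  let D (F : {p : Ideal (𝓞 K) // p.IsMaximal} →₀ (R → ℕ)) := F.support.finsupp fun p =>
    Finset.Iic (F p)
  have hD F G : G ∈ D F ↔ G ≤ F := by
    simp only [D, Finset.mem_finsupp_iff, Finset.mem_Iic]
    refine ⟨fun ⟨hs, h⟩ p => ?_, fun h => ⟨Finsupp.support_mono h, fun p _ => h p⟩⟩
    by_cases hp : p ∈ F.support
    · exact h p hp
    · simp [Finsupp.notMem_support_iff.1 fun hG => hp (hs hG)]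
  refine congrFun (eq_of_sum_le_eq D hD (u := fun F => μ (tupleOfExponents F))
    (v := fun F => F.prod fun _ e => localMoebius 𝒞 e) fun F => ?_) F
  have hset : {d : R → Ideal (𝓞 K) | (∀ ρ, d ρ ≠ ⊥) ∧ ∀ ρ, tupleOfExponents F ρ ≤ d ρ} =
      tupleOfExponents '' (D F : Set ({p : Ideal (𝓞 K) // p.IsMaximal} →₀ (R → ℕ))) := by
    ext d
    simp only [Set.mem_ofPred_eq, Set.mem_image, Finset.mem_coe, hD]
    refine ⟨fun ⟨hd, hle⟩ => ?_, ?_⟩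
    · obtain ⟨G, rfl⟩ := exists_tupleOfExponents_eq hd
      exact ⟨G, (tupleOfExponents_le_iff hA F G).1 hle, rfl⟩
    · rintro ⟨G, hG, rfl⟩
      exact ⟨tupleOfExponents_ne_bot hA G, (tupleOfExponents_le_iff hA F G).2 hG⟩
  have h := hμ _ (tupleOfExponents_ne_bot hA F)
  rw [hset, finsum_mem_image (tupleOfExponents_injective hA).injOn, finsum_mem_coe_finset] at h
  rw [← h, sum_finsupp_prod_eq_prod_sum _ _ _ fun _ => localMoebius_zero h𝒞]
  simp_rw [sum_localMoebius, Finset.prod_ite_zero, Finset.prod_const_one]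
  refine if_congr ((sum_prod_tupleOfExponents_eq_top_iff hA 𝒞 F).trans
    ⟨fun h p _ => h p, fun h p => ?_⟩) rfl rfl
  by_cases hp : p ∈ F.support
  · exact h p hp
  · rw [Finsupp.notMem_support_iff.1 hp]
    exact isAdmissible_zero h𝒞

/-- The term of exponent vector `e` in the local factor at `p`. -/
noncomputable def localTerm (𝒞 : Finset (Finset R)) (s : ℝ)
    (p : {p : Ideal (𝓞 K) // p.IsMaximal}) (e : R → ℕ) : ℝ :=
  localMoebius 𝒞 e / (∏ ρ, (Ideal.absNorm (p.1 ^ e ρ) : ℝ)) ^ s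

theorem localTerm_zero (h𝒞 : 𝒞.Nonempty) (s : ℝ) (p : {p : Ideal (𝓞 K) // p.IsMaximal}) :
    localTerm 𝒞 s p 0 = 1 := by
  simp [localTerm, localMoebius_zero h𝒞]

theorem localTerm_eq_zero (s : ℝ) (p : {p : Ideal (𝓞 K) // p.IsMaximal}) {e : R → ℕ}
    (he : e ∉ Finset.Iic 1) : localTerm 𝒞 s p e = 0 := by
  rw [localTerm, localMoebius_eq_zero_of_not_le_one (by simpa using he), Int.cast_zero, zero_div]

theorem finsupp_prod_localTerm (s : ℝ) (F : {p : Ideal (𝓞 K) // p.IsMaximal} →₀ (R → ℕ)) :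
    F.prod (localTerm 𝒞 s) = (F.prod fun _ e => localMoebius 𝒞 e : ℤ) /
      (∏ ρ, (Ideal.absNorm (tupleOfExponents F ρ) : ℝ)) ^ s := by
  have hN : (∏ ρ, (Ideal.absNorm (tupleOfExponents F ρ) : ℝ)) =
      ∏ p ∈ F.support, ∏ ρ, (Ideal.absNorm (p.1 ^ F p ρ) : ℝ) := by
    rw [Finset.prod_comm]
    refine Finset.prod_congr rfl fun ρ _ => ?_
    rw [tupleOfExponents_apply, Finsupp.prod, map_prod, Nat.cast_prod]
  rw [hN, ← Real.finsetProd_rpow _ _ fun p _ => Finset.prod_nonneg fun ρ _ => Nat.cast_nonneg _]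
  simp only [Finsupp.prod, localTerm, Finset.prod_div_distrib, Int.cast_prod]

theorem summable_sum_abs_localTerm (h𝒞 : 𝒞.Nonempty) {f : ℕ}
    (hf : IsLeast {k : ℕ | ∃ S : Finset R, S.card = k ∧ ∀ σ ∈ 𝒞, ¬ S ⊆ σ} f)
    {s : ℝ} (hs0 : 0 ≤ s) (hs : 1 < f * s) :
    Summable fun p : {p : Ideal (𝓞 K) // p.IsMaximal} =>
      ∑ e ∈ (Finset.Iic 1).erase 0, |localTerm 𝒞 s p e| := by
  refine Summable.of_nonneg_of_le (fun p => Finset.sum_nonneg fun _ _ => abs_nonneg _)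
    (fun p => ?_) (((summable_absNorm_rpow K hs).comp_injective
      (Subtype.val_injective (p := fun p : Ideal (𝓞 K) => p.IsMaximal))).mul_left
      (∑ e ∈ (Finset.Iic 1).erase 0, |(localMoebius 𝒞 e : ℝ)|))
  rw [Finset.sum_mul]
  refine Finset.sum_le_sum fun e he => ?_
  by_cases h0 : localMoebius 𝒞 e = 0
  · simp [localTerm, h0]
  have hN : (1 : ℝ) ≤ Ideal.absNorm p.1 := by
    have hp := prime_of_isMaximal (RingOfIntegers.not_isField K) p
    exact_mod_cast Nat.one_le_iff_ne_zero.2 (Ideal.absNorm_eq_zero_iff.not.2 hp.ne_zero)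
  have hle := le_sum_of_localMoebius_ne_zero h𝒞 hf (Finset.ne_of_mem_erase he) h0
  have hpow : (Ideal.absNorm p.1 : ℝ) ^ (f * s) ≤
      (∏ ρ, (Ideal.absNorm (p.1 ^ e ρ) : ℝ)) ^ s := by
    rw [Real.rpow_mul (Nat.cast_nonneg _), Real.rpow_natCast]
    simp_rw [map_pow, Nat.cast_pow, Finset.prod_pow_eq_pow_sum]
    exact Real.rpow_le_rpow (pow_nonneg (Nat.cast_nonneg _) _) (pow_le_pow_right₀ hN hle) hs0
  have hpos : 0 < (Ideal.absNorm p.1 : ℝ) ^ (f * s) :=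
    Real.rpow_pos_of_pos (zero_lt_one.trans_le hN) _
  rw [localTerm, abs_div, div_eq_mul_inv, Function.comp_apply,
    Real.rpow_neg (Nat.cast_nonneg _), abs_of_pos (hpos.trans_le hpow)]
  exact mul_le_mul_of_nonneg_left (inv_anti₀ hpos hpow) (abs_nonneg _)

end NumberField

open scoped Classical in
/-- Proposition (mobius_function (i)): for `s > 1/f`, (a) the sum `Σ_{d ∈ I^R} |μ(d)|/N(d)^s`
converges; (b) each local factor `s_p(s)` has finitely many nonzero terms; (c) the product
`∏_p s_p(s)` converges absolutely and equals `Σ_{d ∈ I^R} μ(d)/N(d)^s`. -/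
theorem moebius_sum_eq_prod (K : Type*) [Field K] [NumberField K]
    (R : Type*) [Fintype R] [DecidableEq R]
    (𝒞 : Finset (Finset R)) (h𝒞 : 𝒞.Nonempty)
    (hcover : ∀ ρ : R, ∃ σ ∈ 𝒞, ρ ∈ σ)
    (hproper : ∀ σ ∈ 𝒞, σ ≠ Finset.univ)
    (μ : (R → Ideal (𝓞 K)) → ℤ)
    (hμ : ∀ b : R → Ideal (𝓞 K), (∀ ρ, b ρ ≠ ⊥) →
      (if (∑ σ ∈ 𝒞, ∏ ρ ∈ σᶜ, b ρ) = ⊤ then (1 : ℤ) else 0) =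
        ∑ᶠ d ∈ {d : R → Ideal (𝓞 K) | (∀ ρ, d ρ ≠ ⊥) ∧ ∀ ρ, b ρ ≤ d ρ}, μ d)
    (f : ℕ)
    (hf : IsLeast {k : ℕ | ∃ S : Finset R, S.card = k ∧ ∀ σ ∈ 𝒞, ¬ S ⊆ σ} f)
    (s : ℝ) (hs : 1 / (f : ℝ) < s) :
    Summable (fun d : {d : R → Ideal (𝓞 K) // ∀ ρ, d ρ ≠ ⊥} =>
        |(μ d.1 : ℝ)| / (∏ ρ, (Ideal.absNorm (d.1 ρ) : ℝ)) ^ s) ∧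
    (∀ p : Ideal (𝓞 K), p.IsMaximal →
        {e : R → ℕ | (μ (fun ρ => p ^ e ρ) : ℝ) /
            (∏ ρ, (Ideal.absNorm (p ^ e ρ) : ℝ)) ^ s ≠ 0}.Finite) ∧
    Multipliable (fun p : {p : Ideal (𝓞 K) // p.IsMaximal} =>
        ∑ᶠ e : R → ℕ, (μ (fun ρ => (p : Ideal (𝓞 K)) ^ e ρ) : ℝ) /
          (∏ ρ, (Ideal.absNorm ((p : Ideal (𝓞 K)) ^ e ρ) : ℝ)) ^ s) ∧
    Summable (fun p : {p : Ideal (𝓞 K) // p.IsMaximal} =>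
        |(∑ᶠ e : R → ℕ, (μ (fun ρ => (p : Ideal (𝓞 K)) ^ e ρ) : ℝ) /
          (∏ ρ, (Ideal.absNorm ((p : Ideal (𝓞 K)) ^ e ρ) : ℝ)) ^ s) - 1|) ∧
    (∏' p : {p : Ideal (𝓞 K) // p.IsMaximal},
        ∑ᶠ e : R → ℕ, (μ (fun ρ => (p : Ideal (𝓞 K)) ^ e ρ) : ℝ) /
          (∏ ρ, (Ideal.absNorm ((p : Ideal (𝓞 K)) ^ e ρ) : ℝ)) ^ s) =
      ∑' d : {d : R → Ideal (𝓞 K) // ∀ ρ, d ρ ≠ ⊥},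
        (μ d.1 : ℝ) / (∏ ρ, (Ideal.absNorm (d.1 ρ) : ℝ)) ^ s := by
  have hA := RingOfIntegers.not_isField K
  have hfs : 0 ≤ s ∧ 1 < f * s := by
    have hf0 : (0 : ℝ) < f := by
      obtain ⟨S, hS, hSσ⟩ := hf.1
      obtain ⟨σ, hσ⟩ := h𝒞
      refine Nat.cast_pos.2 (hS ▸ Finset.card_pos.2 (Finset.nonempty_iff_ne_empty.2 ?_))
      rintro rfl
      exact hSσ σ hσ (Finset.empty_subset _)
    exact ⟨(one_div_pos.2 hf0).le.trans hs.le, by rwa [div_lt_iff₀' hf0] at hs⟩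
  have hsum := summable_sum_abs_localTerm (K := K) h𝒞 hf hfs.1 hfs.2
  have hμΦ := moebius_tupleOfExponents h𝒞 hμ
  have hlocal (p : {p : Ideal (𝓞 K) // p.IsMaximal}) (e : R → ℕ) :
      (μ (fun ρ => p.1 ^ e ρ) : ℝ) / (∏ ρ, (Ideal.absNorm (p.1 ^ e ρ) : ℝ)) ^ s =
        localTerm 𝒞 s p e := by
    rw [← tupleOfExponents_single, hμΦ,
      Finsupp.prod_single_index (h := fun _ e => localMoebius 𝒞 e) (localMoebius_zero h𝒞),
      localTerm]
  have hglobal (F : {p : Ideal (𝓞 K) // p.IsMaximal} →₀ (R → ℕ)) :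
      (μ (tupleOfExponents F) : ℝ) / (∏ ρ, (Ideal.absNorm (tupleOfExponents F ρ) : ℝ)) ^ s =
        F.prod (localTerm 𝒞 s) := by
    rw [finsupp_prod_localTerm, hμΦ]
  let Φ : ({p : Ideal (𝓞 K) // p.IsMaximal} →₀ (R → ℕ)) ≃
      {d : R → Ideal (𝓞 K) // ∀ ρ, d ρ ≠ ⊥} :=
    Equiv.ofBijective (fun F => ⟨tupleOfExponents F, tupleOfExponents_ne_bot hA F⟩)
      ⟨fun F G h => tupleOfExponents_injective hA (congrArg Subtype.val h),
        fun d => (exists_tupleOfExponents_eq d.2).imp fun F hF => Subtype.ext hF⟩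
  have hfinite (p : {p : Ideal (𝓞 K) // p.IsMaximal}) :
      Function.support (localTerm 𝒞 s p) ⊆ (Finset.Iic (1 : R → ℕ) : Set (R → ℕ)) := fun e he => by
    by_contra h
    exact he (localTerm_eq_zero s p h)
  have hzero := localTerm_zero (K := K) h𝒞 s
  have hvanish (p : {p : Ideal (𝓞 K) // p.IsMaximal}) :
      ∀ e ∉ Finset.Iic (1 : R → ℕ), localTerm 𝒞 s p e = 0 := fun e => localTerm_eq_zero s p
  have h0 : (0 : R → ℕ) ∈ Finset.Iic 1 := by simp
  have hprod := hasProd_sum_of_summable hzero h0 hvanish hsum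
  simp_rw [hlocal, finsum_eq_sum_of_support_subset _ (hfinite _)]
  refine ⟨?_, fun p hp => ?_, hprod.multipliable, ?_, ?_⟩
  · rw [← Φ.summable_iff]
    refine (summable_abs_finsupp_prod hzero hvanish hsum).congr fun F => ?_
    rw [← hglobal, abs_div, abs_of_nonneg (a := (∏ ρ, (_ : ℝ)) ^ s)
      (Real.rpow_nonneg (Finset.prod_nonneg fun _ _ => Nat.cast_nonneg _) _)]
    rfl
  · simp_rw [hlocal ⟨p, hp⟩]
    exact (Finset.finite_toSet _).subset (hfinite ⟨p, hp⟩)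
  · refine hsum.of_nonneg_of_le (fun _ => abs_nonneg _) fun p => ?_
    rw [← Finset.add_sum_erase _ _ h0, hzero, add_sub_cancel_left]
    exact Finset.abs_sum_le_sum_abs _ _
  · rw [hprod.tprod_eq, ← Φ.tsum_eq]
    exact tsum_congr fun F => (hglobal F).symm
end

section
/- For every ε > 0 there exists a constant C_ε > 0 such that Σ_{d ∈ I^R, N(d) ≤ t} |μ(d)| ≤ C_ε · t^{1/f + ε} for all real t ≥ 1. -/
open NumberField

open IsDedekindDomain

/-- Every function on finite sets is the sum of some function over all subsets. -/
theorem Finset.exists_sum_powerset_eq {α M : Type*} [AddCommGroup M]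
    (g : Finset α → M) : ∃ m : Finset α → M, ∀ S, ∑ T ∈ S.powerset, m T = g S := by
  classical
  let m : Finset α → M :=
    Finset.strongInduction fun S m => g S - ∑ T ∈ S.ssubsets.attach, m T.1 (by grind)
  refine ⟨m, fun S => ?_⟩
  have hm : m S = g S - ∑ T ∈ S.ssubsets, m T := by
    rw [← Finset.sum_attach S.ssubsets m]
    exact Finset.strongInduction_eq _ S
  rw [← Finset.insert_erase (Finset.mem_powerset_self S),
    Finset.sum_insert (Finset.notMem_erase _ _), hm]
  exact sub_add_cancel _ _

/-- The Möbius inverse of a function that equals `1` on all sets with fewer than `f` elements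
vanishes on nonempty sets with fewer than `f` elements. -/
theorem Finset.eq_zero_of_sum_powerset_eq_one {α M : Type*} [AddCommGroupWithOne M]
    {m : Finset α → M} {f : ℕ} (hm : ∀ S : Finset α, S.card < f → ∑ T ∈ S.powerset, m T = 1)
    {S : Finset α} (hS : S.Nonempty) (hSf : S.card < f) : m S = 0 := by
  classical
  induction S using Finset.strongInduction with
  | H S ih =>
    have h0 : m ∅ = 1 := by simpa using hm ∅ (by grind)
    have h1 := hm S hSf
    rw [← Finset.add_sum_erase _ _ (Finset.mem_powerset_self S),
      Finset.sum_eq_single_of_mem ∅ (by simp [hS.ne_empty.symm]) ?_, h0] at h1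
    · simpa using h1
    · intro T hT hT0
      have hTS : T ⊂ S := by
        rw [Finset.mem_erase, Finset.mem_powerset] at hT
        exact hT.2.ssubset_of_ne hT.1
      exact ih T hTS (Finset.nonempty_iff_ne_empty.2 hT0) ((Finset.card_lt_card hTS).trans hSf)

namespace IsDedekindDomain

variable {A R : Type*} [CommRing A]

open scoped Classical in
/-- The set of coordinates of a tuple of ideals that are divisible by a given prime. -/
noncomputable def primeSupport [Fintype R] (d : R → Ideal A) (p : HeightOneSpectrum A) :
    Finset R :=
  {ρ | d ρ ≤ p.asIdeal}

theorem mem_primeSupport [Fintype R] {d : R → Ideal A} {p : HeightOneSpectrum A} {ρ : R} :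
    ρ ∈ primeSupport d p ↔ d ρ ≤ p.asIdeal := by
  simp [primeSupport]

open scoped Classical in
/-- The multiplicative function on tuples of ideals that is supported on tuples of squarefree
ideals and whose local factor at `p` is `m` of the set of coordinates divisible by `p`. -/
noncomputable def squarefreeProd [Fintype R] (m : Finset R → ℤ) (d : R → Ideal A) : ℤ :=
  if ∀ ρ, Squarefree (d ρ) then ∏ᶠ p : HeightOneSpectrum A, m (primeSupport d p) else 0

theorem squarefree_of_squarefreeProd_ne_zero [Fintype R] {m : Finset R → ℤ} {d : R → Ideal A}
    (h : squarefreeProd m d ≠ 0) (ρ : R) : Squarefree (d ρ) := by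
  rw [squarefreeProd] at h
  by_contra hρ
  exact h (if_neg fun h' => hρ (h' ρ))

variable [IsDedekindDomain A]

theorem HeightOneSpectrum.eq_of_le {p q : HeightOneSpectrum A} (h : p.asIdeal ≤ q.asIdeal) :
    p = q :=
  HeightOneSpectrum.ext (p.isMaximal.eq_of_le q.isPrime.ne_top h)

/-- A squarefree ideal contains `I` as soon as every prime above it contains `I`. -/
theorem le_of_squarefree {I J : Ideal A} (hI : I ≠ ⊥) (hJ : Squarefree J)
    (h : ∀ p : HeightOneSpectrum A, J ≤ p.asIdeal → I ≤ p.asIdeal) : I ≤ J := by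
  classical
  have hJ0 : J ≠ 0 := hJ.ne_zero
  rw [← Ideal.dvd_iff_le,
    UniqueFactorizationMonoid.dvd_iff_normalizedFactors_le_normalizedFactors hJ0 hI,
    Multiset.le_iff_subset ((UniqueFactorizationMonoid.squarefree_iff_nodup_normalizedFactors
      hJ0).1 hJ)]
  intro P hP
  rw [Ideal.mem_normalizedFactors_iff hJ0] at hP
  rw [Ideal.mem_normalizedFactors_iff hI]
  exact ⟨hP.1, h ⟨P, hP.1, fun h0 => hJ0 (le_bot_iff.1 (h0 ▸ hP.2))⟩ hP.2⟩

theorem finite_setOf_le {I : Ideal A} (hI : I ≠ ⊥) : {J : Ideal A | I ≤ J}.Finite := by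
  have := UniqueFactorizationMonoid.fintypeSubtypeDvd I hI
  have h : {J : Ideal A | J ∣ I}.Finite := Finite.of_fintype {J : Ideal A // J ∣ I}
  simpa only [Ideal.dvd_iff_le] using h

theorem finite_setOf_forall_le [Finite R] {b : R → Ideal A} (hb : ∀ ρ, b ρ ≠ ⊥) :
    {d : R → Ideal A | (∀ ρ, d ρ ≠ ⊥) ∧ ∀ ρ, b ρ ≤ d ρ}.Finite :=
  (Set.Finite.pi fun ρ => finite_setOf_le (hb ρ)).subset fun _ hd ρ _ => hd.2 ρ

theorem exists_finset_primes [Finite R] {b : R → Ideal A} (hb : ∀ ρ, b ρ ≠ ⊥) :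
    ∃ Q : Finset (HeightOneSpectrum A), ∀ p ρ, b ρ ≤ p.asIdeal → p ∈ Q := by
  have h : (⋃ ρ, {p : HeightOneSpectrum A | b ρ ≤ p.asIdeal}).Finite :=
    Set.finite_iUnion fun ρ => (finite_setOf_le (hb ρ)).preimage
      (fun p _ q _ hpq => HeightOneSpectrum.ext hpq)
  exact ⟨h.toFinset, fun p ρ hp => by simpa using ⟨ρ, hp⟩⟩

/-- A function on tuples of nonzero ideals is determined by its sums over divisors. -/
theorem eq_of_finsum_divisors_eq [Finite R] {M : Type*} [AddCommGroup M]
    {μ ν : (R → Ideal A) → M}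
    (h : ∀ b : R → Ideal A, (∀ ρ, b ρ ≠ ⊥) →
      ∑ᶠ d ∈ {d : R → Ideal A | (∀ ρ, d ρ ≠ ⊥) ∧ ∀ ρ, b ρ ≤ d ρ}, μ d =
        ∑ᶠ d ∈ {d : R → Ideal A | (∀ ρ, d ρ ≠ ⊥) ∧ ∀ ρ, b ρ ≤ d ρ}, ν d)
    {b : R → Ideal A} (hb : ∀ ρ, b ρ ≠ ⊥) : μ b = ν b := by
  have : WellFoundedLT (R → (Ideal A)ᵒᵈ) := Function.wellFoundedLT
  have : WellFoundedGT (R → Ideal A) := ⟨this.wf⟩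
  induction b using WellFoundedGT.induction with
  | ind b ih =>
    have hins : {d : R → Ideal A | (∀ ρ, d ρ ≠ ⊥) ∧ ∀ ρ, b ρ ≤ d ρ} =
        insert b {d : R → Ideal A | (∀ ρ, d ρ ≠ ⊥) ∧ b < d} := by
      ext d
      simp only [Set.mem_ofPred_eq, Set.mem_insert_iff]
      constructor
      · rintro ⟨h0, hd⟩
        rcases eq_or_lt_of_le (show b ≤ d from hd) with rfl | hlt
        · exact .inl rfl
        · exact .inr ⟨h0, hlt⟩
      · rintro (rfl | ⟨h0, hlt⟩)
        · exact ⟨hb, fun _ => le_rfl⟩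
        · exact ⟨h0, hlt.le⟩
    have hfin : {d : R → Ideal A | (∀ ρ, d ρ ≠ ⊥) ∧ b < d}.Finite :=
      (finite_setOf_forall_le hb).subset fun d hd => ⟨hd.1, hd.2.le⟩
    have hb' := h b hb
    rw [hins, finsum_mem_insert _ (by simp) hfin, finsum_mem_insert _ (by simp) hfin,
      finsum_mem_congr rfl fun d hd => ih d hd.2 hd.1] at hb'
    exact add_right_cancel hb'

open scoped Classical in
/-- The tuple of squarefree ideals in which `p ∈ Q` divides exactly the coordinates in `T p`. -/
noncomputable def squarefreeTuple (Q : Finset (HeightOneSpectrum A)) (T : Q → Finset R) :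
    R → Ideal A :=
  fun ρ => ∏ p : Q, if ρ ∈ T p then p.1.asIdeal else 1

variable {Q : Finset (HeightOneSpectrum A)} {T : Q → Finset R} {ρ : R}

theorem squarefreeTuple_le_iff {q : HeightOneSpectrum A} :
    squarefreeTuple Q T ρ ≤ q.asIdeal ↔ ∃ p : Q, ρ ∈ T p ∧ p.1 = q := by
  rw [squarefreeTuple, q.isPrime.prod_le]
  refine exists_congr fun p => ?_
  split_ifs with h
  · exact ⟨fun hp => ⟨h, HeightOneSpectrum.eq_of_le hp.2⟩,
      fun hp => ⟨Finset.mem_univ _, hp.2 ▸ le_rfl⟩⟩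
  · simp [h, q.isPrime.ne_top]

theorem squarefree_squarefreeTuple : Squarefree (squarefreeTuple Q T ρ) := by
  refine Finset.squarefree_prod_of_pairwise_isCoprime (fun p _ q _ hpq => ?_) fun p _ => ?_
  · dsimp only [Function.onFun]
    split_ifs
    · exact (Ideal.isCoprime_iff_sup_eq.2 (p.1.isMaximal.coprime_of_ne q.1.isMaximal
        fun h => hpq (Subtype.ext (HeightOneSpectrum.ext h)))).isRelPrime
    all_goals first | exact isRelPrime_one_left | exact isRelPrime_one_right
  · split_ifs
    · exact p.1.prime.irreducible.squarefree
    · exact squarefree_one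

theorem squarefreeTuple_ne_bot : squarefreeTuple Q T ρ ≠ ⊥ :=
  squarefree_squarefreeTuple.ne_zero

theorem primeSupport_squarefreeTuple [Fintype R] (p : Q) :
    primeSupport (squarefreeTuple Q T) p.1 = T p := by
  ext ρ
  simp only [mem_primeSupport, squarefreeTuple_le_iff]
  exact ⟨fun ⟨q, hq, h⟩ => Subtype.ext h ▸ hq, fun h => ⟨p, h, rfl⟩⟩

theorem primeSupport_squarefreeTuple_of_notMem [Fintype R] {p : HeightOneSpectrum A}
    (hp : p ∉ Q) : primeSupport (squarefreeTuple Q T) p = ∅ := by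
  ext ρ
  simp only [mem_primeSupport, squarefreeTuple_le_iff, Finset.notMem_empty, iff_false]
  rintro ⟨q, -, rfl⟩
  exact hp q.2

theorem squarefreeTuple_injective [Fintype R] :
    Function.Injective (squarefreeTuple (R := R) Q) := fun T U h => by
  ext1 p
  rw [← primeSupport_squarefreeTuple (T := T), h, primeSupport_squarefreeTuple]

theorem squarefreeTuple_primeSupport [Fintype R] {d : R → Ideal A}
    (hd : ∀ ρ, Squarefree (d ρ)) (hQ : ∀ p ρ, d ρ ≤ p.asIdeal → p ∈ Q) :
    squarefreeTuple Q (fun p => primeSupport d p.1) = d := by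
  ext1 ρ
  apply le_antisymm
  · exact le_of_squarefree squarefreeTuple_ne_bot (hd ρ) fun p hp =>
      squarefreeTuple_le_iff.2 ⟨⟨p, hQ p ρ hp⟩, mem_primeSupport.2 hp, rfl⟩
  · refine le_of_squarefree (hd ρ).ne_zero squarefree_squarefreeTuple fun p hp => ?_
    obtain ⟨q, hq, rfl⟩ := squarefreeTuple_le_iff.1 hp
    exact mem_primeSupport.1 hq

theorem le_squarefreeTuple_iff [Fintype R] {b : R → Ideal A} (hb : ∀ ρ, b ρ ≠ ⊥) :
    (∀ ρ, b ρ ≤ squarefreeTuple Q T ρ) ↔ ∀ p : Q, T p ⊆ primeSupport b p.1 := by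
  constructor
  · intro h p ρ hρ
    exact mem_primeSupport.2 ((h ρ).trans (squarefreeTuple_le_iff.2 ⟨p, hρ, rfl⟩))
  · intro h ρ
    refine le_of_squarefree (hb ρ) squarefree_squarefreeTuple fun p hp => ?_
    obtain ⟨q, hq, rfl⟩ := squarefreeTuple_le_iff.1 hp
    exact mem_primeSupport.1 (h q hq)

theorem squarefreeProd_squarefreeTuple [Fintype R] {m : Finset R → ℤ} (hm : m ∅ = 1)
    (T : Q → Finset R) : squarefreeProd m (squarefreeTuple Q T) = ∏ p : Q, m (T p) := by
  rw [squarefreeProd, if_pos fun ρ => squarefree_squarefreeTuple,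
    finprod_eq_prod_of_mulSupport_subset _ (s := Q), ← Finset.prod_coe_sort]
  · simp only [primeSupport_squarefreeTuple]
  · intro p hp
    by_contra hpQ
    exact hp (by simpa only [primeSupport_squarefreeTuple_of_notMem hpQ] using hm)

theorem finsum_divisors_squarefreeProd [Fintype R] {m : Finset R → ℤ} (hm : m ∅ = 1)
    {b : R → Ideal A} (hb : ∀ ρ, b ρ ≠ ⊥) (hQ : ∀ p ρ, b ρ ≤ p.asIdeal → p ∈ Q) :
    ∑ᶠ d ∈ {d : R → Ideal A | (∀ ρ, d ρ ≠ ⊥) ∧ ∀ ρ, b ρ ≤ d ρ}, squarefreeProd m d =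
      ∏ p : Q, ∑ U ∈ (primeSupport b p.1).powerset, m U := by
  classical
  rw [Finset.prod_univ_sum, finsum_mem_inter_support_eq' _ _
    (((Fintype.piFinset fun p : Q => (primeSupport b p.1).powerset).image
      (squarefreeTuple Q) : Finset (R → Ideal A)) : Set (R → Ideal A)),
    finsum_mem_coe_finset, Finset.sum_image squarefreeTuple_injective.injOn]
  · simp only [squarefreeProd_squarefreeTuple hm]
  · intro d hd
    have hsq := squarefree_of_squarefreeProd_ne_zero hd
    simp only [Set.mem_ofPred_eq, Finset.coe_image, Set.mem_image, Finset.mem_coe,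
      Fintype.mem_piFinset, Finset.mem_powerset]
    constructor
    · rintro ⟨-, hbd⟩
      refine ⟨fun p => primeSupport d p.1, fun p ρ hρ => ?_,
        squarefreeTuple_primeSupport hsq fun p ρ hp => hQ p ρ ((hbd ρ).trans hp)⟩
      exact mem_primeSupport.2 ((hbd ρ).trans (mem_primeSupport.1 hρ))
    · rintro ⟨T, hT, rfl⟩
      exact ⟨fun _ => squarefreeTuple_ne_bot, (le_squarefreeTuple_iff hb).2 hT⟩

open scoped Classical in
/-- The coprimality condition attached to `𝒞` is a product of local conditions. -/
theorem coprime_indicator_eq_prod [Fintype R] [DecidableEq R] {𝒞 : Finset (Finset R)}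
    (h𝒞 : 𝒞.Nonempty) {b : R → Ideal A} (hb : ∀ ρ, b ρ ≠ ⊥)
    (hQ : ∀ p ρ, b ρ ≤ p.asIdeal → p ∈ Q) :
    (if (∑ σ ∈ 𝒞, ∏ ρ ∈ σᶜ, b ρ) = ⊤ then (1 : ℤ) else 0) =
      ∏ p : Q, if ∃ σ ∈ 𝒞, primeSupport b p.1 ⊆ σ then (1 : ℤ) else 0 := by
  have key (p : HeightOneSpectrum A) :
      (∑ σ ∈ 𝒞, ∏ ρ ∈ σᶜ, b ρ) ≤ p.asIdeal ↔ ¬ ∃ σ ∈ 𝒞, primeSupport b p ⊆ σ := by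
    have hsum : (∑ σ ∈ 𝒞, ∏ ρ ∈ σᶜ, b ρ) = 𝒞.sup fun σ => ∏ ρ ∈ σᶜ, b ρ :=
      Ideal.sum_eq_sup _ _
    rw [hsum, Finset.sup_le_iff]
    push Not
    refine forall₂_congr fun σ _ => ?_
    rw [p.isPrime.prod_le, Finset.not_subset]
    refine exists_congr fun ρ => ?_
    rw [mem_primeSupport, Finset.mem_compl, and_comm]
  split_ifs with h
  · refine (Finset.prod_eq_one fun p _ => if_pos ?_).symm
    by_contra hp
    exact p.1.isPrime.ne_top (top_le_iff.1 (h ▸ (key p.1).2 hp))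
  · obtain ⟨P, hP, hle⟩ := Ideal.exists_le_maximal _ h
    obtain ⟨σ, hσ⟩ := h𝒞
    have hσle : ∏ ρ ∈ σᶜ, b ρ ≤ P :=
      le_trans (by rw [Ideal.sum_eq_sup]; exact Finset.le_sup (f := fun σ => ∏ ρ ∈ σᶜ, b ρ) hσ) hle
    have hP0 : P ≠ ⊥ := fun h0 => Finset.prod_ne_zero_iff.2 (fun ρ _ => hb ρ)
      (le_bot_iff.1 (h0 ▸ hσle))
    let p : HeightOneSpectrum A := ⟨P, hP.isPrime, hP0⟩
    obtain ⟨ρ, -, hρ⟩ := hP.isPrime.prod_le.1 hσle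
    exact (Finset.prod_eq_zero (Finset.mem_univ ⟨p, hQ p ρ hρ⟩) (if_neg ((key p).1 hle))).symm

end IsDedekindDomain

namespace NumberField

variable (K : Type*) [Field K] [NumberField K]

open Filter Asymptotics in
/-- The Dedekind zeta series of `K` converges absolutely at real `s > 1`. -/
theorem summable_card_absNorm_mul_rpow {s : ℝ} (hs : 1 < s) :
    Summable fun n : ℕ =>
      (Nat.card {I : Ideal (𝓞 K) // Ideal.absNorm I = n} : ℝ) * (n : ℝ) ^ (-s) := by
  set c : ℕ → ℝ := fun n => Nat.card {I : Ideal (𝓞 K) // Ideal.absNorm I = n} with hc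
  have hO : (fun n : ℕ => ∑ k ∈ Finset.Icc 1 n, c k) =O[atTop] fun n => (n : ℝ) ^ (1 : ℝ) := by
    have hlim := ((Ideal.tendsto_norm_le_div_atTop₀ K).comp
      tendsto_natCast_atTop_atTop).isBigO_one ℝ
    have hmul := hlim.mul (isBigO_refl (fun n : ℕ => (n : ℝ)) atTop)
    refine (hmul.congr' ?_ ?_)
    · filter_upwards [eventually_gt_atTop 0] with n hn
      have hn0 : (n : ℝ) ≠ 0 := by positivity
      simp only [Function.comp_apply, Nat.cast_le, hc, ← Nat.cast_sum]
      rw [div_mul_cancel₀ _ hn0]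
      congr 1
      rw [← add_left_inj 1, ← Ideal.card_norm_le_eq_card_norm_le_add_one,
        show Finset.Icc 1 n = Finset.Ioc 0 n from Finset.Icc_succ_left_eq_Ioc _ _,
        show 1 = Nat.card {I : Ideal (𝓞 K) // Ideal.absNorm I = 0} by
          simp [Ideal.absNorm_eq_zero_iff],
        Finset.sum_Ioc_add_eq_sum_Icc (n.zero_le),
        ← Finset.card_preimage_eq_sum_card_image_eq
          (fun k _ ↦ Ideal.finite_setOfPred_absNorm_eq k)]
      simp [Set.coe_eq_subtype]
    · exact Eventually.of_forall fun n => by simp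
  have hsum : LSeriesSummable (fun n => (c n : ℂ)) (s : ℂ) :=
    LSeriesSummable_of_sum_norm_bigO_and_nonneg hO (fun n => by positivity) zero_le_one
      (by simpa using hs)
  refine hsum.norm.congr fun n => ?_
  rcases eq_or_ne n 0 with rfl | hn
  · simp [Real.zero_rpow (show -s ≠ 0 by linarith)]
  · rw [LSeries.norm_term_eq, if_neg hn, Complex.ofReal_re, Complex.norm_real, Real.norm_eq_abs,
      abs_of_nonneg (by positivity : 0 ≤ c n), Real.rpow_neg (by positivity), div_eq_mul_inv]

/-- The sums of `N(p) ^ (-s)` over finite sets of primes are bounded for real `s > 1`. -/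
theorem exists_sum_absNorm_rpow_le {s : ℝ} (hs : 1 < s) :
    ∃ Z : ℝ, ∀ Q : Finset (HeightOneSpectrum (𝓞 K)),
      ∑ p ∈ Q, (Ideal.absNorm p.asIdeal : ℝ) ^ (-s) ≤ Z := by
  classical
  refine ⟨_, fun Q => le_trans ?_ ((summable_card_absNorm_mul_rpow K hs).sum_le_tsum
    (Q.image fun p => Ideal.absNorm p.asIdeal) fun n _ => by positivity)⟩
  rw [← Finset.sum_fiberwise_of_maps_to (t := Q.image fun p => Ideal.absNorm p.asIdeal)
    (fun p hp => Finset.mem_image_of_mem _ hp)]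
  refine Finset.sum_le_sum fun n _ => ?_
  rw [Finset.sum_congr rfl (g := fun _ => (n : ℝ) ^ (-s))
    fun p hp => by rw [(Finset.mem_filter.1 hp).2], Finset.sum_const, nsmul_eq_mul]
  gcongr
  have : Finite {I : Ideal (𝓞 K) // Ideal.absNorm I = n} := Ideal.finite_setOfPred_absNorm_eq n
  rw [← Nat.card_eq_finsetCard]
  refine Nat.card_le_card_of_injective
    (fun p => ⟨p.1.asIdeal, (Finset.mem_filter.1 p.2).2⟩) fun p q hpq => ?_
  exact Subtype.ext (HeightOneSpectrum.ext (congrArg Subtype.val hpq))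

variable {K} {R : Type*} [Fintype R]

theorem prod_absNorm_squarefreeTuple {Q : Finset (HeightOneSpectrum (𝓞 K))} (T : Q → Finset R) :
    ∏ ρ, (Ideal.absNorm (squarefreeTuple Q T ρ) : ℝ) =
      ∏ p : Q, (Ideal.absNorm p.1.asIdeal : ℝ) ^ (T p).card := by
  classical
  simp only [squarefreeTuple, map_prod, Nat.cast_prod]
  rw [Finset.prod_comm]
  refine Finset.prod_congr rfl fun p _ => ?_
  simp only [apply_ite Ideal.absNorm, map_one, apply_ite (Nat.cast : ℕ → ℝ), Nat.cast_one]
  rw [Finset.prod_ite_mem, Finset.univ_inter, Finset.prod_const]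

theorem one_le_absNorm {I : Ideal (𝓞 K)} (hI : I ≠ ⊥) : (1 : ℝ) ≤ Ideal.absNorm I :=
  Nat.one_le_cast.2 (Nat.one_le_iff_ne_zero.2 fun h => hI (Ideal.absNorm_eq_zero_iff.1 h))

/-- The local factor of the Dirichlet series of `|m|` is at most
`1 + (∑ U, |m U|) * N(p) ^ (-s * f)`. -/
theorem sum_abs_mul_rpow_le {m : Finset R → ℤ} (hm : m ∅ = 1) {f : ℕ}
    (hmf : ∀ U : Finset R, U.Nonempty → U.card < f → m U = 0) {s x : ℝ} (hs : 0 ≤ s)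
    (hx : 1 ≤ x) :
    ∑ U : Finset R, |(m U : ℝ)| * (x ^ U.card) ^ (-s) ≤
      1 + (∑ U : Finset R, |(m U : ℝ)|) * x ^ (-(s * f)) := by
  classical
  rw [← Finset.add_sum_erase _ _ (Finset.mem_univ ∅)]
  refine add_le_add (by simp [hm]) ?_
  rw [Finset.sum_mul]
  refine (Finset.sum_le_sum fun U hU => ?_).trans
    (Finset.sum_le_sum_of_subset_of_nonneg (Finset.erase_subset _ _) fun U _ _ => by positivity)
  rcases lt_or_ge U.card f with h | h
  · simp [hmf U (Finset.nonempty_iff_ne_empty.2 (Finset.mem_erase.1 hU).1) h]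
  · rw [← Real.rpow_natCast, ← Real.rpow_mul (by positivity)]
    gcongr
    have : (f : ℝ) ≤ U.card := by exact_mod_cast h
    nlinarith

/-- The bound given by the Rankin trick for `|squarefreeProd m|`. -/
theorem exists_finsum_abs_squarefreeProd_le {m : Finset R → ℤ} (hm : m ∅ = 1) {f : ℕ}
    (hmf : ∀ U : Finset R, U.Nonempty → U.card < f → m U = 0) {s : ℝ} (hs : 0 ≤ s)
    (hsf : 1 < s * f) :
    ∃ C : ℝ, 0 < C ∧ ∀ t : ℝ, 1 ≤ t →
      (∑ᶠ d ∈ {d : R → Ideal (𝓞 K) |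
          (∀ ρ, d ρ ≠ ⊥) ∧ (∏ ρ, (Ideal.absNorm (d ρ) : ℝ)) ≤ t},
        |(squarefreeProd m d : ℝ)|) ≤ C * t ^ s := by
  classical
  obtain ⟨Z, hZ⟩ := exists_sum_absNorm_rpow_le K hsf
  set M : ℝ := ∑ U : Finset R, |(m U : ℝ)|
  have hM : 0 ≤ M := by positivity
  refine ⟨Real.exp (M * Z), Real.exp_pos _, fun t ht => ?_⟩
  have hfin : {p : HeightOneSpectrum (𝓞 K) | Ideal.absNorm p.asIdeal ≤ ⌊t⌋₊}.Finite :=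
    (Ideal.finite_setOfPred_absNorm_le ⌊t⌋₊).preimage
      fun p _ q _ hpq => HeightOneSpectrum.ext hpq
  set Q := hfin.toFinset
  set F : Finset (R → Ideal (𝓞 K)) :=
    {d ∈ Finset.univ.image (squarefreeTuple Q) | ∏ ρ, (Ideal.absNorm (d ρ) : ℝ) ≤ t} with hF
  have hsum : (∑ᶠ d ∈ {d : R → Ideal (𝓞 K) |
      (∀ ρ, d ρ ≠ ⊥) ∧ (∏ ρ, (Ideal.absNorm (d ρ) : ℝ)) ≤ t}, |(squarefreeProd m d : ℝ)|) =
      ∑ d ∈ F, |(squarefreeProd m d : ℝ)| := by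
    rw [← finsum_mem_coe_finset]
    refine finsum_mem_inter_support_eq' _ _ _ fun d hd => ?_
    have hsq : ∀ ρ, Squarefree (d ρ) :=
      squarefree_of_squarefreeProd_ne_zero (m := m) fun h0 => hd (by simp [h0])
    simp only [Set.mem_ofPred_eq, hF, Finset.coe_filter, Finset.mem_image, Finset.mem_univ,
      true_and]
    refine and_congr_left fun hdt => ⟨fun h0 => ⟨_, squarefreeTuple_primeSupport hsq ?_⟩, ?_⟩
    · intro p ρ hp
      simp only [Q, Set.Finite.mem_toFinset, Set.mem_ofPred_eq]
      refine Nat.le_floor (le_trans ?_ hdt)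
      calc (Ideal.absNorm p.asIdeal : ℝ) ≤ Ideal.absNorm (d ρ) := by
            refine Nat.cast_le.2 (Nat.le_of_dvd (Nat.pos_of_ne_zero fun h => h0 ρ
              (Ideal.absNorm_eq_zero_iff.1 h)) (Ideal.absNorm_dvd_absNorm_of_le hp))
        _ ≤ ∏ ρ, (Ideal.absNorm (d ρ) : ℝ) := by
            simpa using Finset.prod_le_prod_of_subset_of_one_le (Finset.subset_univ {ρ})
              (fun _ _ => Nat.cast_nonneg _) fun ρ _ _ => one_le_absNorm (h0 ρ)
    · rintro ⟨T, rfl⟩ ρ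
      exact squarefreeTuple_ne_bot
  rw [hsum]
  calc ∑ d ∈ F, |(squarefreeProd m d : ℝ)|
      ≤ ∑ d ∈ F, |(squarefreeProd m d : ℝ)| *
          (t ^ s * (∏ ρ, (Ideal.absNorm (d ρ) : ℝ)) ^ (-s)) := by
        refine Finset.sum_le_sum fun d hd => le_mul_of_one_le_right (abs_nonneg _) ?_
        obtain ⟨hd, hdt⟩ := Finset.mem_filter.1 hd
        obtain ⟨T, -, rfl⟩ := Finset.mem_image.1 hd
        have h1 : 1 ≤ ∏ ρ, (Ideal.absNorm (squarefreeTuple Q T ρ) : ℝ) :=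
          Finset.one_le_prod fun ρ _ => one_le_absNorm squarefreeTuple_ne_bot
        rw [Real.rpow_neg (by positivity), ← div_eq_mul_inv, one_le_div (by positivity)]
        gcongr
    _ ≤ ∑ d ∈ Finset.univ.image (squarefreeTuple Q), |(squarefreeProd m d : ℝ)| *
          (t ^ s * (∏ ρ, (Ideal.absNorm (d ρ) : ℝ)) ^ (-s)) :=
        Finset.sum_le_sum_of_subset_of_nonneg (Finset.filter_subset _ _)
          fun d _ _ => by positivity
    _ = t ^ s * ∑ T : Q → Finset R, ∏ p : Q,
          |(m (T p) : ℝ)| * ((Ideal.absNorm p.1.asIdeal : ℝ) ^ (T p).card) ^ (-s) := by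
        rw [Finset.sum_image squarefreeTuple_injective.injOn, Finset.mul_sum]
        refine Finset.sum_congr rfl fun T _ => ?_
        rw [squarefreeProd_squarefreeTuple hm, prod_absNorm_squarefreeTuple,
          Finset.prod_mul_distrib, Int.cast_prod, Finset.abs_prod,
          Real.finsetProd_rpow _ _ fun p _ => by positivity]
        ring
    _ = t ^ s * ∏ p : Q, ∑ U : Finset R,
          |(m U : ℝ)| * ((Ideal.absNorm p.1.asIdeal : ℝ) ^ U.card) ^ (-s) := by
        rw [Finset.prod_univ_sum, Fintype.piFinset_univ]
    _ ≤ t ^ s * ∏ p : Q, Real.exp (M * (Ideal.absNorm p.1.asIdeal : ℝ) ^ (-(s * f))) := by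
        gcongr with p
        refine (sum_abs_mul_rpow_le hm hmf hs (one_le_absNorm p.1.ne_bot)).trans ?_
        rw [add_comm]
        exact Real.add_one_le_exp _
    _ ≤ t ^ s * Real.exp (M * Z) := by
        rw [← Real.exp_sum, ← Finset.mul_sum,
          Finset.sum_coe_sort Q fun p => (Ideal.absNorm p.asIdeal : ℝ) ^ (-(s * f))]
        gcongr
        exact hZ Q
    _ = Real.exp (M * Z) * t ^ s := mul_comm _ _

end NumberField

open scoped Classical in
/-- Proposition (mobius_function (ii)): for every `ε > 0` there is `C_ε > 0` with
`Σ_{d ∈ I^R, N(d) ≤ t} |μ(d)| ≤ C_ε t^{1/f + ε}` for all `t ≥ 1`. -/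
theorem moebius_partial_sum (K : Type*) [Field K] [NumberField K]
    (R : Type*) [Fintype R] [DecidableEq R]
    (𝒞 : Finset (Finset R)) (h𝒞 : 𝒞.Nonempty)
    (hcover : ∀ ρ : R, ∃ σ ∈ 𝒞, ρ ∈ σ)
    (hproper : ∀ σ ∈ 𝒞, σ ≠ Finset.univ)
    (μ : (R → Ideal (𝓞 K)) → ℤ)
    (hμ : ∀ b : R → Ideal (𝓞 K), (∀ ρ, b ρ ≠ ⊥) →
      (if (∑ σ ∈ 𝒞, ∏ ρ ∈ σᶜ, b ρ) = ⊤ then (1 : ℤ) else 0) =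
        ∑ᶠ d ∈ {d : R → Ideal (𝓞 K) | (∀ ρ, d ρ ≠ ⊥) ∧ ∀ ρ, b ρ ≤ d ρ}, μ d)
    (f : ℕ)
    (hf : IsLeast {k : ℕ | ∃ S : Finset R, S.card = k ∧ ∀ σ ∈ 𝒞, ¬ S ⊆ σ} f)
    (ε : ℝ) (hε : 0 < ε) :
    ∃ C : ℝ, 0 < C ∧ ∀ t : ℝ, 1 ≤ t →
      (∑ᶠ d ∈ {d : R → Ideal (𝓞 K) |
          (∀ ρ, d ρ ≠ ⊥) ∧ (∏ ρ, (Ideal.absNorm (d ρ) : ℝ)) ≤ t}, |(μ d : ℝ)|)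
        ≤ C * t ^ ((f : ℝ)⁻¹ + ε) := by
  classical
  obtain ⟨m, hmg⟩ := Finset.exists_sum_powerset_eq
    fun S : Finset R => if ∃ σ ∈ 𝒞, S ⊆ σ then (1 : ℤ) else 0
  have hm : m ∅ = 1 := by
    obtain ⟨σ, hσ⟩ := h𝒞
    simpa [show ∃ σ, σ ∈ 𝒞 from ⟨σ, hσ⟩] using hmg ∅
  have hmf (U : Finset R) (hU : U.Nonempty) (hUf : U.card < f) : m U = 0 := by
    refine Finset.eq_zero_of_sum_powerset_eq_one (fun S hS => ?_) hU hUf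
    rw [hmg, if_pos]
    by_contra! h
    exact hS.not_ge (hf.2 ⟨S, rfl, h⟩)
  have hf1 : 1 ≤ f := by
    obtain ⟨S, hS, hS𝒞⟩ := hf.1
    obtain ⟨σ, hσ⟩ := h𝒞
    rw [← hS, Finset.one_le_card, Finset.nonempty_iff_ne_empty]
    rintro rfl
    exact hS𝒞 σ hσ (Finset.empty_subset σ)
  have hμm (d : R → Ideal (𝓞 K)) (hd : ∀ ρ, d ρ ≠ ⊥) : μ d = squarefreeProd m d := by
    refine eq_of_finsum_divisors_eq (fun b hb => ?_) hd
    obtain ⟨Q, hQ⟩ := exists_finset_primes hb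
    rw [← hμ b hb, coprime_indicator_eq_prod h𝒞 hb hQ, finsum_divisors_squarefreeProd hm hb hQ]
    exact Finset.prod_congr rfl fun p _ => (hmg _).symm
  have hf0 : (0 : ℝ) < f := by exact_mod_cast hf1
  obtain ⟨C, hC, h⟩ := exists_finsum_abs_squarefreeProd_le (K := K) hm hmf
    (s := (f : ℝ)⁻¹ + ε) (by positivity) (by
      rw [add_mul, inv_mul_cancel₀ hf0.ne']
      linarith [mul_pos hε hf0])
  refine ⟨C, hC, fun t ht => ?_⟩
  rw [finsum_mem_congr rfl fun d hd => by rw [hμm d hd.1]]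
  exact h t ht
end

section
/- For every ε > 0 there exists a constant C_ε > 0 such that Σ_{d ∈ I^R, N(d) ≥ t} |μ(d)|/N(d) ≤ C_ε · t^{1/f − 1 + ε} for all real t ≥ 1 (in particular the sum Σ_{d ∈ I^R} |μ(d)|/N(d) is finite). -/
open NumberField

section Combinatorics

variable {R : Type*} [DecidableEq R]

theorem Finset.exists_sum_powerset_eq_s6 (c : Finset R → ℤ) :
    ∃ a : Finset R → ℤ, ∀ U, ∑ S ∈ U.powerset, a S = c U := by
  refine ⟨Finset.strongInduction fun U a ↦
    c U - ∑ S ∈ U.ssubsets.attach, a S.1 (Finset.mem_ssubsets.1 S.2), fun U ↦ ?_⟩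
  have h : U.powerset = insert U U.ssubsets := by
    rw [Finset.ssubsets, Finset.insert_erase (Finset.mem_powerset_self U)]
  rw [h, Finset.sum_insert (by simp [Finset.mem_ssubsets]), Finset.strongInduction_eq]
  rw [Finset.sum_attach U.ssubsets]
  ring

theorem eq_zero_of_sum_powerset_eq_one {a : Finset R → ℤ} {f : ℕ}
    (h : ∀ U : Finset R, U.card < f → ∑ S ∈ U.powerset, a S = 1) (U : Finset R) (hU : U.Nonempty)
    (hf : U.card < f) : a U = 0 := by
  induction U using Finset.strongInduction with
  | H U ih =>
    have hempty : a ∅ = 1 := by simpa using h ∅ (by simp; omega)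
    have hsum := h U hf
    rw [← Finset.sum_subset (s₁ := {∅, U}) (by simp [Finset.insert_subset_iff])] at hsum
    · rw [Finset.sum_pair hU.ne_empty.symm] at hsum
      omega
    · intro S hS hS'
      simp only [Finset.mem_powerset, Finset.mem_insert, Finset.mem_singleton, not_or] at hS hS'
      have hss := hS.ssubset_of_ne hS'.2
      exact ih S hss (Finset.nonempty_iff_ne_empty.2 hS'.1) ((Finset.card_lt_card hss).trans hf)

end Combinatorics

section Dedekind

open UniqueFactorizationMonoid

variable {A : Type*} [CommRing A] [IsDedekindDomain A]

theorem Ideal.mem_primeFactors_iff {I p : Ideal A} (h : I ≠ ⊥) :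
    p ∈ primeFactors I ↔ Prime p ∧ I ≤ p := by
  rw [mem_primeFactors, mem_normalizedFactors_iff' h, Ideal.dvd_iff_le]
  simp [irreducible_iff_prime]

theorem Ideal.finite_setOf_ge {I : Ideal A} (h : I ≠ ⊥) : {J | I ≤ J}.Finite := by
  have := UniqueFactorizationMonoid.fintypeSubtypeDvd I h
  exact (Set.finite_coe_iff.1 (Finite.of_fintype {J // J ∣ I})).subset
    fun J hJ ↦ Ideal.dvd_iff_le.2 hJ

variable {R : Type*} [Fintype R]

theorem finite_setOf_tuple_ge {b : R → Ideal A} (hb : ∀ ρ, b ρ ≠ ⊥) :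
    {d : R → Ideal A | (∀ ρ, d ρ ≠ ⊥) ∧ ∀ ρ, b ρ ≤ d ρ}.Finite :=
  (Set.Finite.pi' fun ρ ↦ Ideal.finite_setOf_ge (hb ρ)).subset fun _ h ↦ h.2

open scoped Classical in
/-- The coordinates of a tuple of ideals that are divisible by `p`. -/
noncomputable def coordsAt (d : R → Ideal A) (p : Ideal A) : Finset R :=
  Finset.univ.filter fun ρ ↦ d ρ ≤ p

open scoped Classical in
/-- The tuple of squarefree ideals whose coordinates divisible by `p ∈ P` are those in `g p`. -/
noncomputable def idealTuple (P : Finset (Ideal A)) (g : P → Finset R) (ρ : R) : Ideal A :=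
  ∏ p : P with ρ ∈ g p, p.1

open scoped Classical in
/-- The primes dividing some coordinate of a tuple of ideals. -/
noncomputable def tuplePrimes (d : R → Ideal A) : Finset (Ideal A) :=
  Finset.univ.biUnion fun ρ ↦ primeFactors (d ρ)

theorem mem_tuplePrimes {d : R → Ideal A} (hd : ∀ ρ, d ρ ≠ ⊥) {p : Ideal A} :
    p ∈ tuplePrimes d ↔ Prime p ∧ (coordsAt d p).Nonempty := by
  simp only [tuplePrimes, coordsAt, Finset.mem_biUnion, Finset.mem_univ, true_and,
    Ideal.mem_primeFactors_iff (hd _), exists_and_left, Finset.Nonempty, Finset.mem_filter]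

omit [Fintype R] in
theorem idealTuple_ne_bot {P : Finset (Ideal A)} (hP : ∀ p ∈ P, Prime p) (g : P → Finset R)
    (ρ : R) : idealTuple P g ρ ≠ ⊥ :=
  Finset.prod_ne_zero_iff.2 fun p _ ↦ (hP p p.2).ne_zero

omit [Fintype R] in
theorem idealTuple_le_iff {P : Finset (Ideal A)} (hP : ∀ p ∈ P, Prime p) (g : P → Finset R)
    (ρ : R) {q : Ideal A} (hq : Prime q) :
    idealTuple P g ρ ≤ q ↔ ∃ h : q ∈ P, ρ ∈ g ⟨q, h⟩ := by
  rw [idealTuple, ← Ideal.dvd_iff_le, hq.dvd_finsetProd_iff]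
  simp only [Finset.mem_filter, Finset.mem_univ, true_and]
  constructor
  · rintro ⟨⟨p, hp⟩, hρ, hqp⟩
    have : q = p := associated_iff_eq.1 (hq.associated_of_dvd (hP p hp) hqp)
    subst this
    exact ⟨hp, hρ⟩
  · rintro ⟨h, hρ⟩
    exact ⟨⟨q, h⟩, hρ, dvd_rfl⟩

theorem coordsAt_idealTuple {P : Finset (Ideal A)} (hP : ∀ p ∈ P, Prime p) (g : P → Finset R)
    (p : P) : coordsAt (idealTuple P g) p = g p := by
  ext ρ
  simp [coordsAt, idealTuple_le_iff hP g ρ (hP p p.2)]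

omit [Fintype R] in
theorem radical_idealTuple {P : Finset (Ideal A)} (hP : ∀ p ∈ P, Prime p) (g : P → Finset R)
    (ρ : R) : radical (idealTuple P g ρ) = idealTuple P g ρ := by
  rw [idealTuple, radical_prod]
  · refine Finset.prod_congr rfl fun p _ ↦ ?_
    rw [radical_of_prime (hP p p.2), normalize_eq]
  · intro p _ q _ hpq
    rw [Function.onFun, (hP p p.2).irreducible.isRelPrime_iff_not_dvd]
    exact fun h ↦ hpq (Subtype.ext (associated_iff_eq.1 ((hP p p.2).associated_of_dvd (hP q q.2) h)))

theorem idealTuple_coordsAt {P : Finset (Ideal A)} (hP : ∀ p ∈ P, Prime p) {d : R → Ideal A}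
    (hd : ∀ ρ, d ρ ≠ ⊥) (hr : ∀ ρ, radical (d ρ) = d ρ) (hdP : tuplePrimes d ⊆ P) :
    idealTuple P (fun p ↦ coordsAt d p) = d := by
  classical
  funext ρ
  rw [← hr ρ, radical, idealTuple]
  refine Finset.prod_bij (fun p _ ↦ p.1) ?_ (fun _ _ _ _ h ↦ Subtype.ext h) ?_ (fun _ _ ↦ rfl)
  · rintro ⟨p, hp⟩ h
    rw [Ideal.mem_primeFactors_iff (hd ρ)]
    simpa [hP p hp, coordsAt] using h
  · intro p hp
    refine ⟨⟨p, hdP (Finset.mem_biUnion.2 ⟨ρ, Finset.mem_univ ρ, hp⟩)⟩, ?_, rfl⟩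
    rw [Ideal.mem_primeFactors_iff (hd ρ)] at hp
    simpa [coordsAt] using hp.2

open scoped Classical in
/-- The multiplicative function on tuples of ideals, supported on squarefree tuples, with local
factor `a` at each prime. -/
noncomputable def squarefreeExt (a : Finset R → ℤ) (d : R → Ideal A) : ℤ :=
  if ∀ ρ, radical (d ρ) = d ρ then ∏ p ∈ tuplePrimes d, a (coordsAt d p) else 0

theorem squarefreeExt_eq_prod {a : Finset R → ℤ} (ha : a ∅ = 1) {P : Finset (Ideal A)}
    (hP : ∀ p ∈ P, Prime p) {d : R → Ideal A} (hd : ∀ ρ, d ρ ≠ ⊥)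
    (hr : ∀ ρ, radical (d ρ) = d ρ) (hdP : tuplePrimes d ⊆ P) :
    squarefreeExt a d = ∏ p : P, a (coordsAt d p) := by
  rw [squarefreeExt, if_pos hr, Finset.prod_coe_sort P fun p ↦ a (coordsAt d p)]
  refine Finset.prod_subset hdP fun p hp hpd ↦ ?_
  rw [mem_tuplePrimes hd, not_and, Finset.not_nonempty_iff_eq_empty] at hpd
  rw [hpd (hP p hp), ha]

omit [IsDedekindDomain A] in
theorem coordsAt_subset {b d : R → Ideal A} (h : ∀ ρ, b ρ ≤ d ρ) (p : Ideal A) :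
    coordsAt d p ⊆ coordsAt b p := fun ρ hρ ↦ by
  simp only [coordsAt, Finset.mem_filter, Finset.mem_univ, true_and] at hρ ⊢
  exact (h ρ).trans hρ

theorem sum_squarefreeExt {a : Finset R → ℤ} (ha : a ∅ = 1) {b : R → Ideal A}
    (hb : ∀ ρ, b ρ ≠ ⊥) :
    ∑ d ∈ (finite_setOf_tuple_ge hb).toFinset, squarefreeExt a d =
      ∏ p ∈ tuplePrimes b, ∑ S ∈ (coordsAt b p).powerset, a S := by
  classical
  have hP : ∀ p ∈ tuplePrimes b, Prime p := fun p hp ↦ ((mem_tuplePrimes hb).1 hp).1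
  have hsub {d : R → Ideal A} (hd : (∀ ρ, d ρ ≠ ⊥) ∧ ∀ ρ, b ρ ≤ d ρ) :
      tuplePrimes d ⊆ tuplePrimes b := fun p hp ↦ by
    rw [mem_tuplePrimes hd.1] at hp
    exact (mem_tuplePrimes hb).2 ⟨hp.1, hp.2.mono (coordsAt_subset hd.2 p)⟩
  rw [← Finset.prod_coe_sort, Finset.prod_univ_sum,
    ← Finset.sum_filter_of_ne (p := fun d ↦ ∀ ρ, radical (d ρ) = d ρ)
      fun d _ h ↦ by by_contra h'; exact h (if_neg h')]
  refine Finset.sum_bij' (fun d _ p ↦ coordsAt d p) (fun g _ ↦ idealTuple _ g) ?_ ?_ ?_ ?_ ?_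
  · intro d hd
    simp only [Finset.mem_filter, Set.Finite.mem_toFinset, Set.mem_ofPred_eq] at hd
    simpa [Fintype.mem_piFinset] using fun p _ ↦ coordsAt_subset hd.1.2 p
  · intro g hg
    simp only [Fintype.mem_piFinset, Finset.mem_powerset] at hg
    simp only [Finset.mem_filter, Set.Finite.mem_toFinset, Set.mem_ofPred_eq]
    refine ⟨⟨idealTuple_ne_bot hP g, fun ρ ↦ ?_⟩, radical_idealTuple hP g⟩
    rw [← Ideal.dvd_iff_le, ← radical_idealTuple hP g, radical_dvd_iff_primeFactors_subset (hb ρ)]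
    intro p hp
    rw [Ideal.mem_primeFactors_iff (idealTuple_ne_bot hP g ρ)] at hp
    obtain ⟨h, hρ⟩ := (idealTuple_le_iff hP g ρ hp.1).1 hp.2
    rw [Ideal.mem_primeFactors_iff (hb ρ)]
    simpa [coordsAt, hp.1] using hg _ hρ
  · intro d hd
    simp only [Finset.mem_filter, Set.Finite.mem_toFinset, Set.mem_ofPred_eq] at hd
    exact idealTuple_coordsAt hP hd.1.1 hd.2 (hsub hd.1)
  · intro g hg
    funext p
    exact coordsAt_idealTuple hP g p
  · intro d hd
    simp only [Finset.mem_filter, Set.Finite.mem_toFinset, Set.mem_ofPred_eq] at hd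
    exact squarefreeExt_eq_prod ha hP hd.1.1 hd.2 (hsub hd.1)

theorem eq_of_sum_divisors_eq {μ ν : (R → Ideal A) → ℤ}
    (h : ∀ (b : R → Ideal A) (hb : ∀ ρ, b ρ ≠ ⊥),
      ∑ d ∈ (finite_setOf_tuple_ge hb).toFinset, μ d =
        ∑ d ∈ (finite_setOf_tuple_ge hb).toFinset, ν d)
    {b : R → Ideal A} (hb : ∀ ρ, b ρ ≠ ⊥) : μ b = ν b := by
  classical
  induction hn : (finite_setOf_tuple_ge hb).toFinset.card using Nat.strong_induction_on
    generalizing b with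
  | _ n ih =>
    have hmem : b ∈ (finite_setOf_tuple_ge hb).toFinset := by simpa using hb
    have hsum := h b hb
    rw [← Finset.add_sum_erase _ _ hmem, ← Finset.add_sum_erase _ _ hmem,
      Finset.sum_congr rfl fun d hd ↦ ?_] at hsum
    · exact add_right_cancel hsum
    · simp only [Finset.mem_erase, Set.Finite.mem_toFinset, Set.mem_ofPred_eq] at hd
      refine ih _ ?_ hd.2.1 rfl
      rw [← hn]
      refine Finset.card_lt_card (Finset.ssubset_iff_of_subset ?_ |>.2 ⟨b, hmem, ?_⟩)
      · intro e he
        simp only [Set.Finite.mem_toFinset, Set.mem_ofPred_eq] at he ⊢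
        exact ⟨he.1, fun ρ ↦ (hd.2.2 ρ).trans (he.2 ρ)⟩
      · simp only [Set.Finite.mem_toFinset, Set.mem_ofPred_eq, not_and]
        exact fun _ hdb ↦ hd.1 (funext fun ρ ↦ le_antisymm (hdb ρ) (hd.2.2 ρ))

open scoped Classical in
theorem prod_coprimality_indicator [DecidableEq R] {𝒞 : Finset (Finset R)} (h𝒞 : 𝒞.Nonempty)
    (hA : ¬ IsField A) {b : R → Ideal A} (hb : ∀ ρ, b ρ ≠ ⊥) :
    (if (∑ σ ∈ 𝒞, ∏ ρ ∈ σᶜ, b ρ) = ⊤ then (1 : ℤ) else 0) =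
      ∏ p ∈ tuplePrimes b, if ∃ σ ∈ 𝒞, coordsAt b p ⊆ σ then 1 else 0 := by
  have key {p : Ideal A} (hp : Prime p) :
      (∑ σ ∈ 𝒞, ∏ ρ ∈ σᶜ, b ρ) ≤ p ↔ ∀ σ ∈ 𝒞, ¬ coordsAt b p ⊆ σ := by
    rw [Ideal.sum_eq_sup, Finset.sup_le_iff]
    refine forall₂_congr fun σ _ ↦ ?_
    rw [(Ideal.isPrime_of_prime hp).prod_le, Finset.not_subset]
    simp [coordsAt, and_comm]
  rw [Finset.prod_ite_zero, Finset.prod_const_one]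
  refine if_congr ⟨fun h p hp ↦ ?_, fun h ↦ ?_⟩ rfl rfl
  · by_contra! hσ
    have hp' := ((mem_tuplePrimes hb).1 hp).1
    have := (key hp').2 hσ
    rw [h, top_le_iff] at this
    exact (Ideal.isPrime_of_prime hp').ne_top this
  · by_contra htop
    obtain ⟨p, hp, hle⟩ := Ideal.exists_le_maximal _ htop
    have hp' : Prime p :=
      Ideal.prime_of_isPrime (Ring.ne_bot_of_isMaximal_of_not_isField hp hA) hp.isPrime
    rw [key hp'] at hle
    obtain ⟨σ, hσ⟩ := h𝒞
    have hne : (coordsAt b p).Nonempty := by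
      rw [Finset.nonempty_iff_ne_empty]
      intro h0
      exact hle σ hσ (by simp [h0])
    obtain ⟨τ, hτ, hsub⟩ := h p ((mem_tuplePrimes hb).2 ⟨hp', hne⟩)
    exact hle τ hτ hsub

end Dedekind

section NumberField

variable (K : Type*) [Field K] [NumberField K]

open Filter Asymptotics in
theorem NumberField.lseriesSummable_card_absNorm_eq {s : ℝ} (hs : 1 < s) :
    LSeriesSummable (fun n ↦ ((Nat.card {I : Ideal (𝓞 K) // Ideal.absNorm I = n} : ℝ) : ℂ)) s := by
  refine LSeriesSummable_of_sum_norm_bigO_and_nonneg (r := 1) ?_ (fun _ ↦ Nat.cast_nonneg _)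
    zero_le_one (by simpa using hs)
  have h := ((Ideal.tendsto_norm_le_div_atTop K).comp tendsto_natCast_atTop_atTop).isBigO_one ℝ
  refine IsBigO.trans ?_ ((h.mul (isBigO_refl (fun n : ℕ ↦ (n : ℝ)) atTop)).congr' ?_
    (.of_forall fun n ↦ by simp) : (fun n : ℕ ↦
      (Nat.card {I : Ideal (𝓞 K) // Ideal.absNorm I ≤ n} : ℝ)) =O[atTop] _)
  · refine IsBigO.of_norm_le fun n ↦ ?_
    rw [Real.norm_of_nonneg (Finset.sum_nonneg fun _ _ ↦ Nat.cast_nonneg _)]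
    norm_cast
    have := Finset.card_preimage_eq_sum_card_image_eq (s := Finset.Icc 1 n)
      (fun k _ ↦ Ideal.finite_setOfPred_absNorm_eq (S := 𝓞 K) k)
    refine this.symm.trans_le (Nat.card_mono (Ideal.finite_setOfPred_absNorm_le n) fun I hI ↦ ?_)
    exact (Finset.mem_Icc.1 (Finset.mem_coe.1 (Set.mem_preimage.1 hI))).2
  · filter_upwards [eventually_gt_atTop 0] with n hn
    have : (n : ℝ) ≠ 0 := by positivity
    simp [this]

theorem NumberField.exists_sum_absNorm_rpow_le_s6 {s : ℝ} (hs : 1 < s) :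
    ∃ B : ℝ, 0 ≤ B ∧ ∀ T : Finset (Ideal (𝓞 K)), (∀ I ∈ T, I ≠ ⊥) →
      ∑ I ∈ T, (Ideal.absNorm I : ℝ) ^ (-s) ≤ B := by
  classical
  have hsum := (lseriesSummable_card_absNorm_eq K hs).norm
  refine ⟨_, tsum_nonneg fun _ ↦ norm_nonneg _, fun T hT ↦
    le_trans ?_ (hsum.sum_le_tsum (T.image Ideal.absNorm) fun _ _ ↦ norm_nonneg _)⟩
  rw [← Finset.sum_fiberwise_of_maps_to (g := Ideal.absNorm) (t := T.image Ideal.absNorm)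
    fun I hI ↦ Finset.mem_image_of_mem _ hI]
  refine Finset.sum_le_sum fun n hn ↦ ?_
  obtain ⟨J, hJ, rfl⟩ := Finset.mem_image.1 hn
  have hJ0 : Ideal.absNorm J ≠ 0 := by simpa [Ideal.absNorm_eq_zero_iff] using hT J hJ
  rw [LSeries.norm_term_eq, if_neg hJ0, Finset.sum_congr rfl
    fun I hI ↦ by rw [(Finset.mem_filter.1 hI).2], Finset.sum_const, nsmul_eq_mul,
    Real.rpow_neg (Nat.cast_nonneg _), ← div_eq_mul_inv]
  simp only [Complex.norm_real, Real.norm_natCast, Complex.ofReal_re]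
  gcongr
  have : Finite {I : Ideal (𝓞 K) // Ideal.absNorm I = Ideal.absNorm J} :=
    (Ideal.finite_setOfPred_absNorm_eq (S := 𝓞 K) (Ideal.absNorm J)).to_subtype
  rw [← Nat.card_eq_finsetCard]
  exact Nat.card_le_card_of_injective
    (fun I ↦ (⟨I.1, (Finset.mem_filter.1 I.2).2⟩ :
      {I : Ideal (𝓞 K) // Ideal.absNorm I = Ideal.absNorm J}))
    fun I J h ↦ Subtype.ext (by injection h)

variable {K} {R : Type*} [Fintype R]

theorem prod_absNorm_idealTuple (P : Finset (Ideal (𝓞 K))) (g : P → Finset R) :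
    ∏ ρ, Ideal.absNorm (idealTuple P g ρ) = ∏ p : P, Ideal.absNorm p.1 ^ (g p).card := by
  classical
  simp_rw [idealTuple, map_prod, ← Finset.prod_const]
  exact Finset.prod_comm' (by simp)

theorem sum_local_le {a : Finset R → ℤ} (ha : a ∅ = 1) {f : ℕ}
    (haf : ∀ U : Finset R, U.Nonempty → U.card < f → a U = 0) {s : ℝ} (hs : 0 ≤ s) {x : ℝ}
    (hx : 1 ≤ x) :
    ∑ S : Finset R, |(a S : ℝ)| * (x ^ S.card) ^ (-s) ≤
      1 + (∑ S : Finset R, |(a S : ℝ)|) * x ^ (-(f * s)) := by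
  classical
  rw [← Finset.add_sum_erase _ _ (Finset.mem_univ (∅ : Finset R))]
  refine add_le_add (by simp [ha]) ?_
  rw [Finset.sum_mul]
  refine (Finset.sum_le_sum fun S hS ↦ ?_).trans (Finset.sum_le_sum_of_subset_of_nonneg
    (Finset.erase_subset ∅ _) fun _ _ _ ↦ by positivity)
  rcases lt_or_ge S.card f with h | h
  · simp [haf S (Finset.nonempty_iff_ne_empty.2 (Finset.ne_of_mem_erase hS)) h]
  · gcongr
    rw [← Real.rpow_natCast, ← Real.rpow_mul (by positivity)]
    refine Real.rpow_le_rpow_of_exponent_le hx ?_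
    have : (f : ℝ) ≤ S.card := by exact_mod_cast h
    nlinarith

theorem exists_sum_squarefreeExt_le {a : Finset R → ℤ} (ha : a ∅ = 1) {f : ℕ}
    (haf : ∀ U : Finset R, U.Nonempty → U.card < f → a U = 0) {s : ℝ} (hs : 0 ≤ s)
    (hfs : 1 < f * s) :
    ∃ B : ℝ, 0 < B ∧ ∀ T : Finset (R → Ideal (𝓞 K)), (∀ d ∈ T, ∀ ρ, d ρ ≠ ⊥) →
      ∑ d ∈ T, |(squarefreeExt a d : ℝ)| * (∏ ρ, (Ideal.absNorm (d ρ) : ℝ)) ^ (-s) ≤ B := by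
  classical
  obtain ⟨B, hB, hBle⟩ := NumberField.exists_sum_absNorm_rpow_le_s6 K hfs
  set M := ∑ S : Finset R, |(a S : ℝ)|
  have hM0 : 0 ≤ M := Finset.sum_nonneg fun _ _ ↦ abs_nonneg _
  refine ⟨Real.exp (M * B), Real.exp_pos _, fun T hT ↦ ?_⟩
  set P := T.biUnion tuplePrimes
  have hP : ∀ p ∈ P, Prime p := fun p hp ↦ by
    obtain ⟨d, hd, hpd⟩ := Finset.mem_biUnion.1 hp
    exact ((mem_tuplePrimes (hT d hd)).1 hpd).1
  set F : (P → Finset R) → ℝ := fun g ↦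
    ∏ p : P, |(a (g p) : ℝ)| * ((Ideal.absNorm p.1 : ℝ) ^ (g p).card) ^ (-s)
  set T' := T.filter fun d ↦ ∀ ρ, UniqueFactorizationMonoid.radical (d ρ) = d ρ
  have hT' {d} (hd : d ∈ T') : idealTuple P (fun p ↦ coordsAt d p) = d :=
    idealTuple_coordsAt hP (hT d (Finset.mem_filter.1 hd).1) (Finset.mem_filter.1 hd).2
      (Finset.subset_biUnion_of_mem _ (Finset.mem_filter.1 hd).1)
  calc _ = ∑ d ∈ T', |(squarefreeExt a d : ℝ)| * (∏ ρ, (Ideal.absNorm (d ρ) : ℝ)) ^ (-s) := by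
        refine (Finset.sum_filter_of_ne fun d _ h ↦ ?_).symm
        by_contra h'
        exact h (by simp [squarefreeExt, h'])
    _ = ∑ d ∈ T', F fun p ↦ coordsAt d p := by
        refine Finset.sum_congr rfl fun d hd ↦ ?_
        have hd' := Finset.mem_filter.1 hd
        rw [squarefreeExt_eq_prod ha hP (hT d hd'.1) hd'.2 (Finset.subset_biUnion_of_mem _ hd'.1)]
        have hN : ∏ ρ, (Ideal.absNorm (d ρ) : ℝ) =
            ∏ p : P, (Ideal.absNorm p.1 : ℝ) ^ (coordsAt d p.1).card := by
          exact_mod_cast (hT' hd) ▸ prod_absNorm_idealTuple P fun p ↦ coordsAt d p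
        rw [hN, ← Real.finsetProd_rpow _ _ fun _ _ ↦ by positivity, Int.cast_prod, Finset.abs_prod,
          ← Finset.prod_mul_distrib]
    _ = ∑ g ∈ T'.image fun d p ↦ coordsAt d p.1, F g := by
        refine (Finset.sum_image fun d hd e he h ↦ ?_).symm
        rw [← hT' hd, ← hT' he]
        exact congrArg _ h
    _ ≤ ∑ g, F g := Finset.sum_le_sum_of_subset_of_nonneg (Finset.subset_univ _)
        fun g _ _ ↦ Finset.prod_nonneg fun _ _ ↦ by positivity
    _ = ∏ p : P, ∑ S : Finset R, |(a S : ℝ)| * ((Ideal.absNorm p.1 : ℝ) ^ S.card) ^ (-s) := by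
        rw [Finset.prod_univ_sum, Fintype.piFinset_univ]
    _ ≤ ∏ p : P, (1 + M * (Ideal.absNorm p.1 : ℝ) ^ (-(f * s))) := by
        refine Finset.prod_le_prod (fun _ _ ↦ Finset.sum_nonneg fun _ _ ↦ by positivity)
          fun p _ ↦ sum_local_le ha haf hs ?_
        rw [Nat.one_le_cast, Nat.one_le_iff_ne_zero, Ne, Ideal.absNorm_eq_zero_iff]
        exact (hP p p.2).ne_zero
    _ ≤ Real.exp (∑ p : P, M * (Ideal.absNorm p.1 : ℝ) ^ (-(f * s))) :=
        Real.prod_one_add_le_exp_sum _ fun _ ↦ by positivity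
    _ ≤ _ := by
        rw [← Finset.mul_sum, Finset.sum_coe_sort P fun p ↦ (Ideal.absNorm p : ℝ) ^ (-(f * s))]
        gcongr
        exact hBle P fun p hp ↦ (hP p hp).ne_zero

end NumberField

open scoped Classical in
/-- Proposition (mobius_function (iii)): for every `ε > 0` there is `C_ε > 0` such that the
tail sum `Σ_{d ∈ I^R, N(d) ≥ t} |μ(d)|/N(d)` is finite and at most `C_ε t^{1/f - 1 + ε}`
for all `t ≥ 1`. -/
theorem moebius_tail_sum (K : Type*) [Field K] [NumberField K]
    (R : Type*) [Fintype R] [DecidableEq R]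
    (𝒞 : Finset (Finset R)) (h𝒞 : 𝒞.Nonempty)
    (hcover : ∀ ρ : R, ∃ σ ∈ 𝒞, ρ ∈ σ)
    (hproper : ∀ σ ∈ 𝒞, σ ≠ Finset.univ)
    (μ : (R → Ideal (𝓞 K)) → ℤ)
    (hμ : ∀ b : R → Ideal (𝓞 K), (∀ ρ, b ρ ≠ ⊥) →
      (if (∑ σ ∈ 𝒞, ∏ ρ ∈ σᶜ, b ρ) = ⊤ then (1 : ℤ) else 0) =
        ∑ᶠ d ∈ {d : R → Ideal (𝓞 K) | (∀ ρ, d ρ ≠ ⊥) ∧ ∀ ρ, b ρ ≤ d ρ}, μ d)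
    (f : ℕ)
    (hf : IsLeast {k : ℕ | ∃ S : Finset R, S.card = k ∧ ∀ σ ∈ 𝒞, ¬ S ⊆ σ} f)
    (ε : ℝ) (hε : 0 < ε) :
    ∃ C : ℝ, 0 < C ∧ ∀ t : ℝ, 1 ≤ t →
      Summable (fun d : {d : R → Ideal (𝓞 K) //
          (∀ ρ, d ρ ≠ ⊥) ∧ t ≤ ∏ ρ, (Ideal.absNorm (d ρ) : ℝ)} =>
          |(μ d.1 : ℝ)| / ∏ ρ, (Ideal.absNorm (d.1 ρ) : ℝ)) ∧
      (∑' d : {d : R → Ideal (𝓞 K) //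
          (∀ ρ, d ρ ≠ ⊥) ∧ t ≤ ∏ ρ, (Ideal.absNorm (d ρ) : ℝ)},
          |(μ d.1 : ℝ)| / ∏ ρ, (Ideal.absNorm (d.1 ρ) : ℝ))
        ≤ C * t ^ ((f : ℝ)⁻¹ - 1 + ε) := by
  have hf2 : 2 ≤ f := by
    obtain ⟨S, rfl, hS⟩ := hf.1
    by_contra! hlt
    obtain h0 | h1 := Nat.le_one_iff_eq_zero_or_eq_one.1 (Nat.le_of_lt_succ hlt)
    · obtain ⟨σ, hσ⟩ := h𝒞
      exact hS σ hσ (by simp [Finset.card_eq_zero.1 h0])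
    · obtain ⟨ρ, rfl⟩ := Finset.card_eq_one.1 h1
      obtain ⟨σ, hσ, hρ⟩ := hcover ρ
      exact hS σ hσ (by simpa using hρ)
  have hf2' : (2 : ℝ) ≤ f := by exact_mod_cast hf2
  obtain ⟨a, ha⟩ := Finset.exists_sum_powerset_eq_s6
    fun U : Finset R ↦ if ∃ σ ∈ 𝒞, U ⊆ σ then (1 : ℤ) else 0
  have hsmall (U : Finset R) (hU : U.card < f) : ∑ S ∈ U.powerset, a S = 1 := by
    rw [ha, if_pos]
    by_contra! h
    exact hU.not_ge (hf.2 ⟨U, rfl, h⟩)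
  have ha1 : a ∅ = 1 := by simpa using hsmall ∅ (by simp; omega)
  have hμ' {d : R → Ideal (𝓞 K)} (hd : ∀ ρ, d ρ ≠ ⊥) : μ d = squarefreeExt a d := by
    refine eq_of_sum_divisors_eq (fun b hb ↦ ?_) hd
    rw [← finsum_mem_eq_finite_toFinset_sum, ← hμ b hb, sum_squarefreeExt ha1 hb,
      prod_coprimality_indicator h𝒞 (RingOfIntegers.not_isField K) hb]
    exact Finset.prod_congr rfl fun p _ ↦ (ha _).symm
  set s : ℝ := min ((f : ℝ)⁻¹ + ε) 1 with hs
  have hfpos : (0 : ℝ) < f := by linarith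
  have hs0 : (f : ℝ)⁻¹ < s := lt_min (by linarith) (inv_lt_one_of_one_lt₀ (by linarith))
  have hs1 : s ≤ 1 := min_le_right _ _
  obtain ⟨B, hB, hBle⟩ := exists_sum_squarefreeExt_le (K := K) ha1
    (eq_zero_of_sum_powerset_eq_one hsmall) ((inv_pos.2 hfpos).trans hs0).le
    ((inv_lt_iff_one_lt_mul₀' hfpos).1 hs0)
  refine ⟨B, hB, fun t ht ↦ ?_⟩
  have ht0 : 0 < t := by linarith
  have key (u : Finset {d : R → Ideal (𝓞 K) //
      (∀ ρ, d ρ ≠ ⊥) ∧ t ≤ ∏ ρ, (Ideal.absNorm (d ρ) : ℝ)}) :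
      ∑ d ∈ u, |(μ d.1 : ℝ)| / ∏ ρ, (Ideal.absNorm (d.1 ρ) : ℝ) ≤
        B * t ^ ((f : ℝ)⁻¹ - 1 + ε) := by
    have hle := hBle (u.map (Function.Embedding.subtype _)) fun d hd ↦ by
      obtain ⟨e, _, rfl⟩ := Finset.mem_map.1 hd
      exact e.2.1
    rw [Finset.sum_map] at hle
    calc _ ≤ ∑ d ∈ u, |(squarefreeExt a d.1 : ℝ)| *
          (∏ ρ, (Ideal.absNorm (d.1 ρ) : ℝ)) ^ (-s) * t ^ (s - 1) := by
          refine Finset.sum_le_sum fun d _ ↦ ?_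
          have hN := ht0.trans_le d.2.2
          rw [hμ' d.2.1, mul_assoc, div_eq_mul_inv]
          gcongr
          rw [← Real.rpow_neg_one, show (-1 : ℝ) = -s + (s - 1) by ring, Real.rpow_add hN]
          exact mul_le_mul_of_nonneg_left
            (Real.rpow_le_rpow_of_nonpos ht0 d.2.2 (by linarith)) (by positivity)
      _ ≤ B * t ^ (s - 1) := by
          rw [← Finset.sum_mul]
          gcongr
          exact hle
      _ ≤ _ := by
          gcongr
          linarith [min_le_left ((f : ℝ)⁻¹ + ε) 1]
  have hnn (d : {d : R → Ideal (𝓞 K) //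
      (∀ ρ, d ρ ≠ ⊥) ∧ t ≤ ∏ ρ, (Ideal.absNorm (d ρ) : ℝ)}) :
      0 ≤ |(μ d.1 : ℝ)| / ∏ ρ, (Ideal.absNorm (d.1 ρ) : ℝ) := by positivity
  exact ⟨summable_of_sum_le hnn key, Real.tsum_le_of_sum_le hnn key⟩
end

section
/- Let p be a maximal ideal of 𝓞 and let (e_ρ)_{ρ∈R} be nonnegative integers with e_ρ ≥ 2 for some ρ ∈ R. Then μ((p^{e_ρ})_{ρ∈R}) = 0. -/
open NumberField

/-- If the sums of `m` over initial segments only depend on the support of the exponents,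
then `m` vanishes at every vector with an entry at least two. -/
theorem eq_zero_of_sum_Iic_eq_sum_Iic_inf_one {R : Type*} [Fintype R] [DecidableEq R]
    (m : (R → ℕ) → ℤ)
    (hm : ∀ e : R → ℕ, ∑ f ∈ Finset.Iic e, m f = ∑ f ∈ Finset.Iic (e ⊓ 1), m f)
    (e : R → ℕ) (he : ∃ ρ, 2 ≤ e ρ) : m e = 0 := by
  induction e using WellFoundedLT.induction with
  | ind e ih =>
    have hsub : Finset.Iic (e ⊓ 1) ⊆ Finset.Iic e := Finset.Iic_subset_Iic.2 inf_le_left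
    have h := hm e
    rw [← Finset.sum_sdiff hsub, add_eq_right, Finset.sum_eq_single e] at h
    · exact h
    · intro f hf hne
      simp only [Finset.mem_sdiff, Finset.mem_Iic, le_inf_iff, not_and] at hf
      obtain ⟨ρ, hρ⟩ := not_forall.1 (hf.2 hf.1)
      refine ih f (lt_of_le_of_ne hf.1 hne) ⟨ρ, ?_⟩
      simp only [Pi.one_apply] at hρ
      omega
    · intro hmem
      obtain ⟨ρ, hρ⟩ := he
      refine absurd ?_ hmem
      simp only [Finset.mem_sdiff, Finset.mem_Iic, le_refl, true_and]
      intro hle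
      have := hle ρ
      simp only [Pi.inf_apply, Pi.one_apply] at this
      omega

/-- A sum of products of powers of a maximal ideal is the whole ring if and only if one of the
products has only trivial factors. -/
theorem Ideal.IsMaximal.sum_prod_pow_eq_top_iff {A R ι : Type*} [CommRing A] {p : Ideal A}
    (hp : p.IsMaximal) (s : Finset ι) (t : ι → Finset R) (e : R → ℕ) :
    (∑ i ∈ s, ∏ ρ ∈ t i, p ^ e ρ) = ⊤ ↔ ∃ i ∈ s, ∀ ρ ∈ t i, e ρ = 0 := by
  constructor
  · intro h
    by_contra! hne
    refine hp.ne_top (top_le_iff.1 (h ▸ ?_))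
    rw [Ideal.sum_eq_sup]
    refine Finset.sup_le fun i hi => ?_
    obtain ⟨ρ, hρ, hρ0⟩ := hne i hi
    exact (Ideal.prod_le_inf.trans (Finset.inf_le hρ)).trans (Ideal.pow_le_self hρ0)
  · rintro ⟨i, hi, h⟩
    rw [Ideal.sum_eq_sup, ← top_le_iff]
    refine le_trans ?_ (Finset.le_sup hi)
    rw [Finset.prod_eq_one fun ρ hρ => by rw [h ρ hρ, pow_zero], Ideal.one_eq_top]

/-- The tuples of ideals dividing a tuple of powers of a prime are tuples of smaller powers. -/
theorem Ideal.finsum_mem_pow_le_eq_sum_Iic {A R : Type*} [CommRing A] [IsDedekindDomain A]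
    [Fintype R] [DecidableEq R] {p : Ideal A} (hp : Prime p) (μ : (R → Ideal A) → ℤ)
    (e : R → ℕ) :
    ∑ᶠ d ∈ {d : R → Ideal A | (∀ ρ, d ρ ≠ ⊥) ∧ ∀ ρ, p ^ e ρ ≤ d ρ}, μ d =
      ∑ f ∈ Finset.Iic e, μ (fun ρ => p ^ f ρ) := by
  have hinj : Function.Injective fun f : R → ℕ => fun ρ => p ^ f ρ := fun f g hfg =>
    funext fun ρ => pow_injective_of_not_isUnit hp.not_isUnit hp.ne_zero (congrFun hfg ρ)
  have hset : {d : R → Ideal A | (∀ ρ, d ρ ≠ ⊥) ∧ ∀ ρ, p ^ e ρ ≤ d ρ} =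
      (fun f : R → ℕ => fun ρ => p ^ f ρ) '' (Finset.Iic e : Finset (R → ℕ)) := by
    ext d
    simp only [Set.mem_ofPred_eq, Set.mem_image, Finset.coe_Iic, Set.mem_Iic]
    constructor
    · rintro ⟨-, hd⟩
      have h : ∀ ρ, ∃ i ≤ e ρ, d ρ = p ^ i := fun ρ => by
        obtain ⟨i, hi, h⟩ := (dvd_prime_pow hp _).1 (Ideal.dvd_iff_le.2 (hd ρ))
        exact ⟨i, hi, associated_iff_eq.1 h⟩
      choose f hf hdf using h
      exact ⟨f, hf, funext fun ρ => (hdf ρ).symm⟩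
    · rintro ⟨f, hf, rfl⟩
      exact ⟨fun ρ => pow_ne_zero _ hp.ne_zero, fun ρ => Ideal.pow_le_pow_right (hf ρ)⟩
  rw [hset, finsum_mem_image hinj.injOn, finsum_mem_coe_finset]

open scoped Classical in
/-- If some exponent `e_ρ` is at least 2, then `μ((p^{e_ρ})_ρ) = 0`. -/
theorem moebius_vanishes_on_squares (K : Type*) [Field K] [NumberField K]
    (R : Type*) [Fintype R] [DecidableEq R]
    (𝒞 : Finset (Finset R)) (h𝒞 : 𝒞.Nonempty)
    (μ : (R → Ideal (𝓞 K)) → ℤ)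
    (hμ : ∀ b : R → Ideal (𝓞 K), (∀ ρ, b ρ ≠ ⊥) →
      (if (∑ σ ∈ 𝒞, ∏ ρ ∈ σᶜ, b ρ) = ⊤ then (1 : ℤ) else 0) =
        ∑ᶠ d ∈ {d : R → Ideal (𝓞 K) | (∀ ρ, d ρ ≠ ⊥) ∧ ∀ ρ, b ρ ≤ d ρ}, μ d)
    (p : Ideal (𝓞 K)) (hp : p.IsMaximal)
    (e : R → ℕ) (he : ∃ ρ : R, 2 ≤ e ρ) :
    μ (fun ρ => p ^ e ρ) = 0 := by
  have hbot : p ≠ ⊥ := Ring.ne_bot_of_isMaximal_of_not_isField hp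
    (RingOfIntegers.not_isField K)
  have hprime : Prime p := Ideal.prime_of_isPrime hbot hp.isPrime
  have hsum (e : R → ℕ) := (hμ (fun ρ => p ^ e ρ) fun ρ => pow_ne_zero _ hbot).trans
    (Ideal.finsum_mem_pow_le_eq_sum_Iic hprime μ e)
  refine eq_zero_of_sum_Iic_eq_sum_Iic_inf_one (fun f => μ fun ρ => p ^ f ρ) (fun e => ?_) e he
  rw [← hsum, ← hsum]
  simp only [hp.sum_prod_pow_eq_top_iff, Pi.inf_apply, Pi.one_apply]
  have h (ρ : R) : e ρ ⊓ 1 = 0 ↔ e ρ = 0 := by omega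
  simp only [h]
end

section
/- Let p be a maximal ideal of 𝓞 and let (e_ρ)_{ρ∈R} be nonnegative integers, not all zero, such that the support {ρ ∈ R : e_ρ > 0} is contained in σ for some σ ∈ 𝒞. Then μ((p^{e_ρ})_{ρ∈R}) = 0. Consequently, if (e_ρ)_{ρ∈R} are nonnegative integers, not all zero, with μ((p^{e_ρ})_{ρ∈R}) ≠ 0, then Σ_{ρ∈R} e_ρ ≥ f, i.e. N(p)^f divides N((p^{e_ρ})_{ρ∈R}). -/
open NumberField

/-- A tuple of ideals dividing a tuple of powers of a prime ideal is a tuple of smaller powers. -/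
theorem exists_eq_pow_of_forall_pow_le {A R : Type*} [CommRing A] [IsDedekindDomain A]
    {p : Ideal A} (hp : Prime p) {e : R → ℕ} {d : R → Ideal A} (hd : ∀ ρ, p ^ e ρ ≤ d ρ) :
    ∃ e' : R → ℕ, e' ≤ e ∧ d = fun ρ => p ^ e' ρ := by
  have h (ρ : R) : ∃ i ≤ e ρ, d ρ = p ^ i := by
    obtain ⟨i, hi, h⟩ := (dvd_prime_pow hp _).1 (Ideal.dvd_iff_le.2 (hd ρ))
    exact ⟨i, hi, associated_iff_eq.1 h⟩
  choose e' he' hde' using h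
  exact ⟨e', he', funext hde'⟩

/-- The coprimality condition holds trivially for tuples supported on one of the cones. -/
theorem sum_prod_compl_eq_top {A R : Type*} [CommRing A] [Fintype R] [DecidableEq R]
    {𝒞 : Finset (Finset R)} {σ : Finset R} (hσ : σ ∈ 𝒞) {b : R → Ideal A}
    (hb : ∀ ρ ∉ σ, b ρ = ⊤) : ∑ τ ∈ 𝒞, ∏ ρ ∈ τᶜ, b ρ = ⊤ := by
  have h : ∏ ρ ∈ σᶜ, b ρ = ⊤ := by
    rw [← Ideal.one_eq_top]
    exact Finset.prod_eq_one fun ρ hρ => by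
      rw [hb ρ (Finset.mem_compl.1 hρ), Ideal.one_eq_top]
  rw [← Finset.add_sum_erase _ _ hσ, h, Submodule.add_eq_sup, top_sup_eq]

open scoped Classical in
/-- If the support of a nonzero exponent vector `e` is contained in some `σ ∈ 𝒞`, then
`μ((p^{e_ρ})_ρ) = 0`; consequently, if `μ((p^{e_ρ})_ρ) ≠ 0` (with `e` not all zero), then
`Σ_ρ e_ρ ≥ f`, i.e. `N(p)^f` divides `N((p^{e_ρ})_ρ)`. -/
theorem moebius_support_cone (K : Type*) [Field K] [NumberField K]
    (R : Type*) [Fintype R] [DecidableEq R]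
    (𝒞 : Finset (Finset R)) (h𝒞 : 𝒞.Nonempty)
    (hcover : ∀ ρ : R, ∃ σ ∈ 𝒞, ρ ∈ σ)
    (hproper : ∀ σ ∈ 𝒞, σ ≠ Finset.univ)
    (μ : (R → Ideal (𝓞 K)) → ℤ)
    (hμ : ∀ b : R → Ideal (𝓞 K), (∀ ρ, b ρ ≠ ⊥) →
      (if (∑ σ ∈ 𝒞, ∏ ρ ∈ σᶜ, b ρ) = ⊤ then (1 : ℤ) else 0) =
        ∑ᶠ d ∈ {d : R → Ideal (𝓞 K) | (∀ ρ, d ρ ≠ ⊥) ∧ ∀ ρ, b ρ ≤ d ρ}, μ d)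
    (f : ℕ)
    (hf : IsLeast {k : ℕ | ∃ S : Finset R, S.card = k ∧ ∀ σ ∈ 𝒞, ¬ S ⊆ σ} f)
    (p : Ideal (𝓞 K)) (hp : p.IsMaximal) :
    (∀ e : R → ℕ, (∃ ρ, e ρ ≠ 0) → (∃ σ ∈ 𝒞, ∀ ρ, e ρ ≠ 0 → ρ ∈ σ) →
      μ (fun ρ => p ^ e ρ) = 0) ∧
    (∀ e : R → ℕ, (∃ ρ, e ρ ≠ 0) → μ (fun ρ => p ^ e ρ) ≠ 0 →
      f ≤ ∑ ρ, e ρ ∧ Ideal.absNorm p ^ f ∣ ∏ ρ, Ideal.absNorm (p ^ e ρ)) := by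
  have hp0 : p ≠ ⊥ := Ring.ne_bot_of_isMaximal_of_not_isField hp (RingOfIntegers.not_isField K)
  have hprime : Prime p := Ideal.prime_of_isPrime hp0 hp.isPrime
  have hpow (e : R → ℕ) (ρ : R) : p ^ e ρ ≠ ⊥ := pow_ne_zero _ hp0
  have h1 : μ (fun _ => ⊤) = 1 := by
    obtain ⟨σ, hσ⟩ := h𝒞
    have h := hμ (fun _ => ⊤) (fun _ => top_ne_bot)
    have hset : {d : R → Ideal (𝓞 K) | (∀ ρ, d ρ ≠ ⊥) ∧ ∀ ρ, (⊤ : Ideal (𝓞 K)) ≤ d ρ} =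
        {fun _ => ⊤} := by
      ext d
      simp only [Set.mem_ofPred_eq, Set.mem_singleton_iff, top_le_iff]
      exact ⟨fun hd => funext hd.2, fun hd => by simp [hd]⟩
    rw [if_pos (sum_prod_compl_eq_top hσ fun _ _ => rfl), hset, finsum_mem_singleton] at h
    exact h.symm
  have hvanish (σ : Finset R) (hσ : σ ∈ 𝒞) (e : R → ℕ) :
      e ≠ 0 → (∀ ρ, e ρ ≠ 0 → ρ ∈ σ) → μ (fun ρ => p ^ e ρ) = 0 := by
    induction e using WellFoundedLT.induction with
    | ind e ih =>
    intro he hsupp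
    have h := hμ (fun ρ => p ^ e ρ) (hpow e)
    have hb : ∀ ρ ∉ σ, p ^ e ρ = ⊤ := fun ρ hρ => by
      rw [not_imp_comm.1 (hsupp ρ) hρ, pow_zero, Ideal.one_eq_top]
    have hne : (fun _ => ⊤ : R → Ideal (𝓞 K)) ≠ fun ρ => p ^ e ρ := by
      obtain ⟨ρ, hρ⟩ := Function.ne_iff.1 he
      intro heq
      have hle : p ^ e ρ ≤ p := Ideal.pow_le_self hρ
      exact hp.ne_top (top_le_iff.1 ((congrFun heq ρ).le.trans hle))
    rw [if_pos (sum_prod_compl_eq_top hσ hb),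
      finsum_mem_inter_support_eq' μ _ {fun _ => ⊤, fun ρ => p ^ e ρ} ?_,
      finsum_mem_pair hne, h1] at h
    · lia
    · intro d hd
      simp only [Set.mem_ofPred_eq, Set.mem_insert_iff, Set.mem_singleton_iff]
      constructor
      · rintro ⟨-, hle⟩
        obtain ⟨e', he', rfl⟩ := exists_eq_pow_of_forall_pow_le hprime hle
        by_contra! hcon
        refine hd (ih e' (lt_of_le_of_ne he' ?_) ?_ fun ρ hρ => hsupp ρ fun h0 => ?_)
        · rintro rfl
          exact hcon.2 rfl
        · rintro rfl
          exact hcon.1 (by simp [Ideal.one_eq_top])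
        · exact hρ (Nat.le_zero.1 (h0 ▸ he' ρ))
      · rintro (rfl | rfl)
        · exact ⟨fun _ => top_ne_bot, fun _ => le_top⟩
        · exact ⟨hpow e, fun _ => le_rfl⟩
  have hne {e : R → ℕ} (he : ∃ ρ, e ρ ≠ 0) : e ≠ 0 := Function.ne_iff.2 he
  refine ⟨fun e he ⟨σ, hσ, hsupp⟩ => hvanish σ hσ e (hne he) hsupp, fun e he hμe => ?_⟩
  have hfe : f ≤ ∑ ρ, e ρ := by
    have hle : f ≤ (Finset.univ.filter fun ρ => e ρ ≠ 0).card := by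
      refine hf.2 ⟨_, rfl, fun σ hσ hsub => hμe (hvanish σ hσ e (hne he) fun ρ hρ => hsub ?_)⟩
      simpa using hρ
    refine hle.trans ?_
    rw [Finset.card_filter]
    exact Finset.sum_le_sum fun ρ _ => by split_ifs <;> lia
  refine ⟨hfe, ?_⟩
  simp_rw [map_pow, Finset.prod_pow_eq_pow_sum]
  exact pow_dvd_pow _ hfe
end

section
/- Let K be a number field with ring of integers 𝓞, R a finite set, 𝒞 a nonempty finite collection of subsets of R, and for each σ ∈ 𝒞 and ρ ∈ R let a_{σ,ρ} be a nonnegative integer with a_{σ,ρ} = 0 whenever ρ ∈ σ. Let (c_ρ)_{ρ∈R} be nonzero fractional ideals of K such that ∏_{ρ∈R} c_ρ^{a_{σ,ρ}} = ∏_{ρ∈R} c_ρ for every σ ∈ 𝒞. Let (x_ρ)_{ρ∈R} with x_ρ ∈ c_ρ and x_ρ ≠ 0 for all ρ, and suppose Σ_{σ∈𝒞} ∏_{ρ∈R∖σ} (x_ρ)c_ρ^{−1} = 𝓞, where (x_ρ) denotes the principal fractional ideal generated by x_ρ (note each (x_ρ)c_ρ^{−1} is an integral ideal). Then, as fractional ideals,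 Σ_{σ∈𝒞} ∏_{ρ∈R} (x_ρ)^{a_{σ,ρ}} = ∏_{ρ∈R} c_ρ; equivalently, for every maximal ideal p of 𝓞, min_{σ∈𝒞} Σ_{ρ∈R} a_{σ,ρ}·v_p(x_ρ) = v_p(∏_{ρ∈R} c_ρ). -/
open NumberField
open scoped nonZeroDivisors

/-- If, for each `i ∈ s`, the primes dividing `J i` all divide `I i`, and the `I i` generate the
unit ideal, then so do the `J i`. -/
theorem Ideal.sum_eq_one_of_forall_isPrime {A ι : Type*} [CommRing A] (s : Finset ι)
    (I J : ι → Ideal A) (h : ∀ i ∈ s, ∀ m : Ideal A, m.IsPrime → J i ≤ m → I i ≤ m)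
    (hI : ∑ i ∈ s, I i = 1) : ∑ i ∈ s, J i = 1 := by
  rw [Ideal.one_eq_top] at hI ⊢
  by_contra hJ
  obtain ⟨m, hm, hJm⟩ := Ideal.exists_le_maximal _ hJ
  refine hm.ne_top (top_le_iff.mp ?_)
  rw [← hI, Ideal.sum_eq_sup]
  rw [Ideal.sum_eq_sup] at hJm
  exact Finset.sup_le fun i hi => h i hi m hm.isPrime ((Finset.le_sup hi).trans hJm)

/-- Proposition (height2, arithmetic core): if `x_ρ ∈ c_ρ` are nonzero elements with
`Σ_{σ∈𝒞} ∏_{ρ∉σ} (x_ρ)c_ρ⁻¹ = 𝓞`, and `∏_ρ c_ρ^{a_{σ,ρ}} = ∏_ρ c_ρ` for all `σ`, then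
`Σ_{σ∈𝒞} ∏_ρ (x_ρ)^{a_{σ,ρ}} = ∏_ρ c_ρ` as fractional ideals. -/
theorem height_nonarchimedean (K : Type*) [Field K] [NumberField K]
    (R : Type*) [Fintype R] [DecidableEq R]
    (𝒞 : Finset (Finset R)) (h𝒞 : 𝒞.Nonempty)
    (a : Finset R → R → ℕ) (ha : ∀ σ ∈ 𝒞, ∀ ρ ∈ σ, a σ ρ = 0)
    (c : R → FractionalIdeal (𝓞 K)⁰ K) (hc : ∀ ρ, c ρ ≠ 0)
    (hprod : ∀ σ ∈ 𝒞, (∏ ρ, c ρ ^ a σ ρ) = ∏ ρ, c ρ)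
    (x : R → K) (hxmem : ∀ ρ, x ρ ∈ c ρ) (hx0 : ∀ ρ, x ρ ≠ 0)
    (hcop : (∑ σ ∈ 𝒞, ∏ ρ ∈ σᶜ,
        (FractionalIdeal.spanSingleton (𝓞 K)⁰ (x ρ) * (c ρ)⁻¹)) = 1) :
    (∑ σ ∈ 𝒞, ∏ ρ, FractionalIdeal.spanSingleton (𝓞 K)⁰ (x ρ) ^ a σ ρ) = ∏ ρ, c ρ := by
  have hB : ∀ ρ, ∃ B : Ideal (𝓞 K), (B : FractionalIdeal (𝓞 K)⁰ K) =
      FractionalIdeal.spanSingleton (𝓞 K)⁰ (x ρ) * (c ρ)⁻¹ := fun ρ => by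
    refine FractionalIdeal.le_one_iff_exists_coeIdeal.mp ?_
    rw [← mul_inv_cancel₀ (hc ρ)]
    gcongr
    exact FractionalIdeal.spanSingleton_le_iff_mem.mpr (hxmem ρ)
  choose B hB using hB
  have hx : ∀ ρ, FractionalIdeal.spanSingleton (𝓞 K)⁰ (x ρ) =
      (B ρ : FractionalIdeal (𝓞 K)⁰ K) * c ρ := fun ρ => by
    rw [hB, inv_mul_cancel_right₀ (hc ρ)]
  let φ := FractionalIdeal.coeIdealHom (𝓞 K)⁰ K
  have hφ : ∀ I : Ideal (𝓞 K), (I : FractionalIdeal (𝓞 K)⁰ K) = φ I := fun _ => rfl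
  have hcopB : ∑ σ ∈ 𝒞, ∏ ρ ∈ σᶜ, B ρ = 1 := by
    apply FractionalIdeal.coeIdeal_injective (K := K)
    simp only [hφ, map_sum, map_prod, map_one]
    simpa only [← hφ, hB] using hcop
  have hsum : ∑ σ ∈ 𝒞, ∏ ρ, B ρ ^ a σ ρ = 1 := by
    refine Ideal.sum_eq_one_of_forall_isPrime 𝒞 _ _ (fun σ hσ m hm hle => ?_) hcopB
    obtain ⟨ρ, -, hρ⟩ := (Ideal.IsPrime.prod_le hm).mp hle
    have haρ : a σ ρ ≠ 0 := fun h0 => hm.ne_top (by simpa [h0] using hρ)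
    have hρσ : ρ ∈ σᶜ := Finset.mem_compl.mpr fun h => haρ (ha σ hσ ρ h)
    exact (Ideal.IsPrime.prod_le hm).mpr ⟨ρ, hρσ, hm.le_of_pow_le hρ⟩
  calc ∑ σ ∈ 𝒞, ∏ ρ, FractionalIdeal.spanSingleton (𝓞 K)⁰ (x ρ) ^ a σ ρ
      = ∑ σ ∈ 𝒞, φ (∏ ρ, B ρ ^ a σ ρ) * ∏ ρ, c ρ := by
        refine Finset.sum_congr rfl fun σ hσ => ?_
        simp only [hx, mul_pow, Finset.prod_mul_distrib, hprod σ hσ, hφ, map_prod, map_pow]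
    _ = ∏ ρ, c ρ := by rw [← Finset.sum_mul, ← map_sum, hsum, map_one, one_mul]
end
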